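/- arXiv:0806.2928 — 13 statements merged into one kernel-verified Lean document; each statement's English description precedes it below -/
import Mathlib

section
/- Every nondegenerate square-free symmetric set (X,r) satisfies condition lri, i.e. (ˣy)ˣ = y = ˣ(yˣ) for all x,y ∈ X; consequently r is uniquely determined by the left actions via r(x,y) = (L_x(y), L_y⁻¹(x)) for all x,y ∈ X, and (X,r) satisfies the cyclic conditions: ^{(yˣ)}x = ʸx, x^{(ˣy)} = xʸ, ^{(ˣy)}x = ʸx, and x^{(yˣ)} = xʸ for all x,y ∈ X. -/
/-! Statement 0: Every nondegenerate square-free symmetric set satisfies **lri**,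
is determined by its left actions via `r(x,y) = (L_x y, L_y⁻¹ x)`, and is cyclic. -/

namespace YB0

variable {X : Type*}

/-- The left action `ˣy` of a quadratic map `r`. -/
def la (r : X × X → X × X) (x y : X) : X := (r (x, y)).1

/-- The right action `x^y` of a quadratic map `r`; `ra r y` is the map `R_y`. -/
def ra (r : X × X → X × X) (y x : X) : X := (r (x, y)).2

/-- Nondegeneracy: all left and right actions are bijective. -/
def Nondeg (r : X × X → X × X) : Prop :=
  (∀ x, Function.Bijective (la r x)) ∧ (∀ y, Function.Bijective (ra r y))

/-- Square-free: `r(x,x) = (x,x)`. -/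
def SqFree (r : X × X → X × X) : Prop := ∀ x, r (x, x) = (x, x)

/-- Involutive: `r ∘ r = id`. -/
def Invol (r : X × X → X × X) : Prop := ∀ p, r (r p) = p

/-- `r` acting in positions 1,2 of `X × X × X`. -/
def m12 (F : X × X → X × X) : X × X × X → X × X × X :=
  fun p => ((F (p.1, p.2.1)).1, (F (p.1, p.2.1)).2, p.2.2)

/-- `r` acting in positions 2,3 of `X × X × X`. -/
def m23 (F : X × X → X × X) : X × X × X → X × X × X :=
  fun p => (p.1, F (p.2.1, p.2.2))

/-- The Yang–Baxter equation for a map `X × X → X × X`. -/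
def YBE (F : X × X → X × X) : Prop :=
  m12 F ∘ m23 F ∘ m12 F = m23 F ∘ m12 F ∘ m23 F

/-- Condition **lri**: `(ˣy)ˣ = y = ˣ(yˣ)`. -/
def Lri (r : X × X → X × X) : Prop :=
  ∀ x y, ra r x (la r x y) = y ∧ la r x (ra r x y) = y

theorem la_la_of_ybe {r : X × X → X × X} (hybe : YBE r) (x y z : X) :
    la r (la r x y) (la r (ra r y x) z) = la r x (la r y z) :=
  congrArg (fun p : X × X × X => p.1) (congrFun hybe (x, y, z))

theorem la_la_ra_of_invol {r : X × X → X × X} (hinv : Invol r) (x y : X) :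
    la r (la r x y) (ra r y x) = x :=
  congrArg Prod.fst (hinv (x, y))

theorem ra_ra_la_of_invol {r : X × X → X × X} (hinv : Invol r) (x y : X) :
    ra r (ra r y x) (la r x y) = y :=
  congrArg Prod.snd (hinv (x, y))

/-- A square-free involutive solution of the Yang–Baxter equation with injective left actions
satisfies `Lri`: apply the equation to `(y, x, y^x)`. -/
theorem lri_of_sqFree {r : X × X → X × X} (hla : ∀ x, Function.Injective (la r x))
    (hsf : SqFree r) (hinv : Invol r) (hybe : YBE r) : Lri r := by
  have hself : ∀ x, la r x x = x := fun x => congrArg Prod.fst (hsf x)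
  have hl : ∀ x y, la r x (ra r x y) = y := by
    intro x y
    apply hla y
    rw [← la_la_of_ybe hybe, hself, la_la_ra_of_invol hinv, hself]
  exact fun x y => ⟨hla x (hl x _), hl x y⟩

theorem stmt0 (r : X × X → X × X) (hbij : Function.Bijective r)
    (hnd : Nondeg r) (hsf : SqFree r) (hinv : Invol r) (hybe : YBE r) :
    Lri r ∧
    -- `r` is determined by the left actions: `r(x,y) = (L_x y, L_y⁻¹ x)`
    (∀ x y : X, (r (x, y)).1 = la r x y ∧ la r y (r (x, y)).2 = x) ∧
    -- cyclic condition cl1 : `^{(yˣ)}x = ʸx`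
    (∀ x y : X, la r (ra r x y) x = la r y x) ∧
    -- cyclic condition cr1 : `x^{(ˣy)} = xʸ`
    (∀ x y : X, ra r (la r x y) x = ra r y x) ∧
    -- cyclic condition cl2 : `^{(ˣy)}x = ʸx`
    (∀ x y : X, la r (la r x y) x = la r y x) ∧
    -- cyclic condition cr2 : `x^{(yˣ)} = xʸ`
    (∀ x y : X, ra r (ra r x y) x = ra r y x) := by
  have hlri := lri_of_sqFree (fun x => (hnd.1 x).1) hsf hinv hybe
  have cl1 : ∀ x y, la r (ra r x y) x = la r y x := fun x y =>
    (congrArg (la r (ra r x y)) (ra_ra_la_of_invol hinv y x)).symm.trans (hlri _ _).2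
  have cr1 : ∀ x y, ra r (la r x y) x = ra r y x := fun x y =>
    (congrArg (ra r (la r x y)) (la_la_ra_of_invol hinv x y)).symm.trans (hlri _ _).1
  refine ⟨hlri, fun x y => ⟨rfl, (hlri y x).2⟩, cl1, cr1, fun x y => ?_, fun x y => ?_⟩
  · rw [← cl1 x (la r x y), (hlri x y).1]
  · rw [← cr1 x (ra r x y), (hlri x y).2]

end YB0
end

section
/- Let (X,r) be a nondegenerate square-free symmetric set of finite order. Then the condition L_{ˣy} = L_y for all x,y ∈ X holds if and only if every left action L_x, x ∈ X, is an automorphism of (X,r), i.e. (L_x × L_x) ∘ r = r ∘ (L_x × L_x) as maps X × X → X × X for every x ∈ X. -/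
namespace YB

variable {X : Type*}

/-- The left action `ˣy` of a quadratic map `r`. -/
def la (r : X × X → X × X) (x y : X) : X := (r (x, y)).1

/-- The right action `x^y` of a quadratic map `r`; `ra r y` is the map `R_y`. -/
def ra (r : X × X → X × X) (y x : X) : X := (r (x, y)).2

/-- Nondegeneracy: all left and right actions are bijective. -/
def Nondeg (r : X × X → X × X) : Prop :=
  (∀ x, Function.Bijective (la r x)) ∧ (∀ y, Function.Bijective (ra r y))

/-- Square-free: `r(x,x) = (x,x)`. -/
def SqFree (r : X × X → X × X) : Prop := ∀ x, r (x, x) = (x, x)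

/-- Involutive: `r ∘ r = id`. -/
def Invol (r : X × X → X × X) : Prop := ∀ p, r (r p) = p

/-- `r` acting in positions 1,2 of `X × X × X`. -/
def m12 (F : X × X → X × X) : X × X × X → X × X × X :=
  fun p => ((F (p.1, p.2.1)).1, (F (p.1, p.2.1)).2, p.2.2)

/-- `r` acting in positions 2,3 of `X × X × X`. -/
def m23 (F : X × X → X × X) : X × X × X → X × X × X :=
  fun p => (p.1, F (p.2.1, p.2.2))

/-- The Yang–Baxter equation for a map `X × X → X × X`. -/
def YBE (F : X × X → X × X) : Prop :=
  m12 F ∘ m23 F ∘ m12 F = m23 F ∘ m12 F ∘ m23 F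

/-- The permutation group `𝒢(X,r)`: the subgroup of `Sym(X)` generated by the
left actions `L_x`. -/
def Gcal (r : X × X → X × X) : Subgroup (Equiv.Perm X) :=
  Subgroup.closure {g : Equiv.Perm X | ∃ x, (g : X → X) = la r x}


theorem Invol.la_la_ra {r : X × X → X × X} (hinv : Invol r) (x y : X) :
    la r (la r x y) (ra r y x) = x :=
  congrArg Prod.fst (hinv (x, y))

theorem YBE.la_la {r : X × X → X × X} (hybe : YBE r) (x y z : X) :
    la r (la r x y) (la r (ra r y x) z) = la r x (la r y z) :=
  congrArg (fun p : X × X × X => p.1) (congrFun hybe (x, y, z))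

/-- for a finite nondegenerate square-free symmetric set,
`L_{ˣy} = L_y` for all `x,y` iff every `L_x` is an automorphism of `(X,r)`,
i.e. `(L_x × L_x) ∘ r = r ∘ (L_x × L_x)`. -/
theorem stmt2 [Fintype X] (r : X × X → X × X) (hbij : Function.Bijective r)
    (hnd : Nondeg r) (hsf : SqFree r) (hinv : Invol r) (hybe : YBE r) :
    (∀ x y : X, la r (la r x y) = la r y) ↔
      (∀ x a b : X,
        r (la r x a, la r x b) = (la r x (r (a, b)).1, la r x (r (a, b)).2)) := by
  constructor
  · intro h
    have la_ra (x y : X) : la r (ra r y x) = la r x := by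
      rw [← h (la r x y) (ra r y x), hinv.la_la_ra]
    have comm (x y z : X) : la r x (la r y z) = la r y (la r x z) := by
      rw [← hybe.la_la, h, la_ra]
    intro x a b
    refine Prod.ext ?_ ?_
    · change la r (la r x a) (la r x b) = la r x (la r a b)
      rw [h, comm]
    · change ra r (la r x b) (la r x a) = la r x (ra r b a)
      have la_right_ra (u v : X) : la r v (ra r v u) = u := by
        simpa only [h] using hinv.la_la_ra u v
      apply (hnd.1 b).injective
      rw [comm, la_right_ra, ← h x b, la_right_ra]
  · intro h
    have la_ra (x y : X) : la r (ra r y x) = la r x := by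
      funext z
      apply (hnd.1 (la r x y)).injective
      rw [hybe.la_la]
      exact (congrArg Prod.fst (h x y z)).symm
    intro z u
    obtain ⟨y, hy⟩ := (hnd.1 (la r z u)).surjective z
    have hu : ra r y (la r z u) = u := by
      apply (hnd.1 z).injective
      simpa only [hy] using hinv.la_la_ra (la r z u) y
    rw [← la_ra (la r z u) y, hu]

end YB
end

section
/- Let (X,r) be a nondegenerate square-free symmetric set satisfying L_{ˣy} = L_y for all x,y ∈ X. Then the left actions pairwise commute: L_x ∘ L_y = L_y ∘ L_x for all x,y ∈ X; in particular the group 𝒢(X,r) is abelian. -/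
namespace YB

variable {X : Type*}

/-- In an involutive set with `L_{ˣy} = L_y`, one also has `L_{x^y} = L_x`. -/
theorem la_ra_eq {r : X × X → X × X} (hinv : Invol r)
    (h2 : ∀ x y : X, la r (la r x y) = la r y) (x y : X) :
    la r (ra r y x) = la r x := by
  have h : la r (la r x y) (ra r y x) = x := congrArg Prod.fst (hinv (x, y))
  rw [← h2 (la r x y) (ra r y x), h]

/-- The Yang–Baxter equation gives `L_{ˣy} ∘ L_{x^y} = L_x ∘ L_y`. -/
theorem YBE.la_comp {r : X × X → X × X} (hybe : YBE r) (x y : X) :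
    la r (la r x y) ∘ la r (ra r y x) = la r x ∘ la r y :=
  funext fun z => congrArg (fun p : X × X × X => p.1) (congrFun hybe (x, y, z))

/-- for a nondegenerate square-free symmetric set with
`L_{ˣy} = L_y` for all `x,y`, the left actions pairwise commute and
the group `𝒢(X,r)` is abelian. -/
theorem stmt3 (r : X × X → X × X) (hbij : Function.Bijective r)
    (hnd : Nondeg r) (hsf : SqFree r) (hinv : Invol r) (hybe : YBE r)
    (h2 : ∀ x y : X, la r (la r x y) = la r y) :
    (∀ x y : X, la r x ∘ la r y = la r y ∘ la r x) ∧
    (∀ g ∈ Gcal r, ∀ h ∈ Gcal r, g * h = h * g) := by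
  have hcomm (x y : X) : la r x ∘ la r y = la r y ∘ la r x := by
    rw [← hybe.la_comp, h2, la_ra_eq hinv h2]
  refine ⟨hcomm, fun g hg h hh => ?_⟩
  refine Subgroup.closure_induction₂ (p := fun a b _ _ => Commute a b) ?_
    (fun _ _ => Commute.one_left _) (fun _ _ => Commute.one_right _)
    (fun _ _ _ _ _ _ h₁ h₂ => h₁.mul_left h₂) (fun _ _ _ _ _ _ h₁ h₂ => h₁.mul_right h₂)
    (fun _ _ _ _ h => h.inv_left) (fun _ _ _ _ h => h.inv_right) hg hh
  rintro a b ⟨x, hx⟩ ⟨y, hy⟩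
  apply DFunLike.coe_injective
  rw [Equiv.Perm.coe_mul, Equiv.Perm.coe_mul, hx, hy, hcomm]

end YB
end

section
/- Let (X,r) be a nondegenerate square-free symmetric set satisfying L_{ˣy} = L_y for all x,y ∈ X. Then for every pair x,y ∈ X lying in the same orbit of the group 𝒢(X,r) one has ˣy = y and xʸ = x; that is, the restriction of r to each 𝒢(X,r)-orbit is the trivial solution r(x,y) = (y,x). -/
namespace YB

variable {X : Type*}

/-- If `L_{ˣy} = L_y` for all `x, y`, then `L` is constant on `𝒢(X,r)`-orbits. -/
theorem la_apply_of_mem_Gcal {r : X × X → X × X}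
    (h2 : ∀ x y : X, la r (la r x y) = la r y) {g : Equiv.Perm X} (hg : g ∈ Gcal r) (x : X) :
    la r (g x) = la r x := by
  induction hg using Subgroup.closure_induction generalizing x with
  | mem g hg =>
    obtain ⟨z, hz⟩ := hg
    rw [hz, h2]
  | one => rfl
  | mul g h _ _ ihg ihh => rw [Equiv.Perm.mul_apply, ihg, ihh]
  | inv g _ ih => rw [← ih, ← Equiv.Perm.mul_apply, mul_inv_cancel, Equiv.Perm.one_apply]

/-- for a nondegenerate square-free symmetric set with
`L_{ˣy} = L_y` for all `x,y`, any two points in the same `𝒢(X,r)`-orbit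
satisfy `ˣy = y` and `xʸ = x`, i.e. `r` restricted to each orbit is trivial. -/
theorem stmt4 (r : X × X → X × X) (hbij : Function.Bijective r)
    (hnd : Nondeg r) (hsf : SqFree r) (hinv : Invol r) (hybe : YBE r)
    (h2 : ∀ x y : X, la r (la r x y) = la r y) :
    ∀ x y : X, (∃ g ∈ Gcal r, g x = y) →
      la r x y = y ∧ ra r y x = x := by
  rintro x y ⟨g, hg, rfl⟩
  have hself (z : X) : la r z z = z := by rw [la, hsf]
  have hL := la_apply_of_mem_Gcal h2 hg x
  have hxy : la r x (g x) = g x := by rw [← hL, hself]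
  refine ⟨hxy, (hnd.1 (g x)).1 ?_⟩
  rw [congrFun hL x, hself]
  have hr : r (x, g x) = (g x, ra r (g x) x) := Prod.ext hxy rfl
  rw [la, ← hr, hinv]

end YB
end

section
/- Let (X,r) be a nondegenerate square-free symmetric set of finite order satisfying L_{ˣy} = L_y for all x,y ∈ X, let Xᵢ be an orbit of 𝒢(X,r), and let x ∈ X. Then all orbits in Xᵢ of the cyclic group generated by the restriction of L_x to Xᵢ have the same cardinality; that is, the restriction of L_x to Xᵢ is a product of disjoint cycles of equal length whose union is all of Xᵢ. -/
namespace YB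

variable {X : Type*}

/-- The Yang–Baxter equation makes the left actions compatible with `r`. -/
theorem la_la_of_ybe {r : X × X → X × X} (hybe : YBE r) (a b c : X) :
    la r (la r a b) (la r (ra r b a) c) = la r a (la r b c) :=
  congrArg (fun p : X × X × X => p.1) (congrFun hybe (a, b, c))

/-- If `L_{ˣy} = L_y` for all `x, y`, the left actions commute. -/
theorem la_comm {r : X × X → X × X} (hinv : Invol r) (hybe : YBE r)
    (h2 : ∀ x y : X, la r (la r x y) = la r y) (a b : X) :
    Function.Commute (la r a) (la r b) := by
  intro c
  have hra : la r (ra r b a) = la r a := by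
    rw [← h2 (la r a b) (ra r b a)]
    exact congrArg (la r) (congrArg Prod.fst (hinv (a, b)))
  rw [← la_la_of_ybe hybe, h2, hra]

/-- If the left actions commute, every element of `𝒢(X,r)` commutes with each of them. -/
theorem commute_la_of_mem_Gcal {r : X × X → X × X}
    (hc : ∀ a b, Function.Commute (la r a) (la r b)) (x : X)
    {g : Equiv.Perm X} (hg : g ∈ Gcal r) : Function.Commute g (la r x) := by
  induction hg using Subgroup.closure_induction with
  | mem g hg =>
    obtain ⟨a, ha⟩ := hg
    rw [ha]
    exact hc a x
  | one => exact fun _ => rfl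
  | mul g h _ _ hg hh => exact hg.comp_left hh
  | inv g _ hg =>
    intro y
    rw [Equiv.Perm.inv_eq_iff_eq, hg, ← Equiv.Perm.mul_apply, mul_inv_cancel, Equiv.Perm.one_apply]

/-- for a finite nondegenerate square-free symmetric set with
`L_{ˣy} = L_y` for all `x,y`, for each `𝒢(X,r)`-orbit `Xᵢ` (the orbit of `x₀`)
and each `x ∈ X`, the cycles of `L_x` inside `Xᵢ` stay in `Xᵢ` and all have the
same cardinality. -/
theorem stmt5 [Fintype X] (r : X × X → X × X) (hbij : Function.Bijective r)
    (hnd : Nondeg r) (hsf : SqFree r) (hinv : Invol r) (hybe : YBE r)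
    (h2 : ∀ x y : X, la r (la r x y) = la r y) (x₀ x : X) :
    ∀ y z : X, (∃ g ∈ Gcal r, g x₀ = y) → (∃ g ∈ Gcal r, g x₀ = z) →
      ({w : X | ∃ n : ℕ, (la r x)^[n] y = w} ⊆ {w : X | ∃ g ∈ Gcal r, g x₀ = w}) ∧
      Set.ncard {w : X | ∃ n : ℕ, (la r x)^[n] y = w} =
        Set.ncard {w : X | ∃ n : ℕ, (la r x)^[n] z = w} := by
  have hc := la_comm hinv hybe h2
  rintro y z ⟨g, hg, rfl⟩ ⟨h, hh, rfl⟩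
  constructor
  · rintro _ ⟨n, rfl⟩
    have hL : Equiv.ofBijective _ (hnd.1 x) ∈ Gcal r := Subgroup.subset_closure ⟨x, rfl⟩
    refine ⟨Equiv.ofBijective _ (hnd.1 x) ^ n * g, mul_mem (pow_mem hL n) hg, ?_⟩
    rw [Equiv.Perm.mul_apply, Equiv.Perm.coe_pow]
    rfl
  · have hk : h * g⁻¹ ∈ Gcal r := mul_mem hh (inv_mem hg)
    have himage : {w : X | ∃ n : ℕ, (la r x)^[n] (h x₀) = w} =
        (h * g⁻¹) '' {w : X | ∃ n : ℕ, (la r x)^[n] (g x₀) = w} := by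
      change Set.range _ = _ '' Set.range _
      rw [← Set.range_comp]
      congr 1
      funext n
      have hn := (commute_la_of_mem_Gcal hc x hk).iterate_right n (g x₀)
      simpa using hn.symm
    rw [himage, Set.ncard_image_of_injective _ (h * g⁻¹).injective]

end YB
end

section
/- Let X₁ and X₂ be finite sets, let A₁ ⊆ Sym(X₁) and A₂ ⊆ Sym(X₂) be finite abelian groups acting transitively and freely on X₁ and X₂ respectively, fix base points x₁ ∈ X₁ and x₂ ∈ X₂, and fix σ₂ ∈ A₁ and σ₁ ∈ A₂. Let R : ℂX₁ ⊗ ℂX₂ → ℂX₂ ⊗ ℂX₁ be the linear map defined on basis elements by R(e_u ⊗ e_v) = e_{σ₁(v)} ⊗ e_{σ₂⁻¹(u)} for u ∈ X₁, v ∈ X₂. For characters χ : A₁ → ℂˣ and ψ : A₂ → ℂˣ, set y_χ = Σ_{π ∈ A₁} χ(π⁻¹) e_{π(x₁)} and y_ψ = Σ_{ρ ∈ A₂} ψ(ρ⁻¹) e_{ρ(x₂)}. Then R(y_χ ⊗ y_ψ) = (ψ(σ₁)/χ(σ₂)) · (y_ψ ⊗ y_χ). (This is the diagonalization underlying the main theorem: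 for a finite square-free multipermutation solution of level 2, with Xᵢ, Xⱼ two 𝒢-orbits, A_i, A_j the restricted permutation groups, σ₂ = σʲᵢ the common action of elements of Xⱼ on Xᵢ and σ₁ = σⁱⱼ the common action of elements of Xᵢ on Xⱼ, the linear extension R of r satisfies R(e_u ⊗ e_v) = e_{ᵘv} ⊗ e_{u^v} and hence takes this diagonal form in the character basis.) -/
/-! Statement 8: the diagonalization underlying the main theorem.  Two finite
abelian groups `A₁, A₂` act transitively and freely on finite sets `X₁, X₂`;
`R(e_u ⊗ e_v) = e_{σ₁(v)} ⊗ e_{σ₂⁻¹(u)}`.  Then on the character eigenvectors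
`y_χ, y_ψ` one has `R(y_χ ⊗ y_ψ) = (ψ(σ₁)/χ(σ₂)) · (y_ψ ⊗ y_χ)`. -/

open scoped TensorProduct

/-- Translating a character sum over an orbit by `σ` multiplies it by the value of the character
at `σ`. -/
theorem sum_character_smul_single_smul {X A : Type*} [Group A] [Fintype A] [MulAction A X]
    (χ : A →* ℂˣ) (x : X) (σ : A) :
    ∑ π : A, ((χ π⁻¹ : ℂˣ) : ℂ) • Finsupp.single (σ • π • x) (1 : ℂ)
      = ((χ σ : ℂˣ) : ℂ) • ∑ π : A, ((χ π⁻¹ : ℂˣ) : ℂ) • Finsupp.single (π • x) (1 : ℂ) := by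
  rw [Finset.smul_sum]
  refine Fintype.sum_equiv (Equiv.mulLeft σ) _ _ fun π => ?_
  have h : ((χ π⁻¹ : ℂˣ) : ℂ) = ((χ σ : ℂˣ) : ℂ) * ((χ (σ * π)⁻¹ : ℂˣ) : ℂ) := by
    rw [← Units.val_mul, map_inv, map_inv, map_mul, mul_inv, mul_inv_cancel_left]
  rw [Equiv.coe_mulLeft, smul_smul, smul_smul, h]

theorem stmt8 {X₁ X₂ A₁ A₂ : Type*} [Fintype X₁] [Fintype X₂]
    [CommGroup A₁] [Fintype A₁] [CommGroup A₂] [Fintype A₂]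
    [MulAction A₁ X₁] [MulAction A₂ X₂]
    (htrans₁ : ∀ z z' : X₁, ∃ a : A₁, a • z = z')
    (hfree₁ : ∀ (a : A₁) (z : X₁), a • z = z → a = 1)
    (htrans₂ : ∀ z z' : X₂, ∃ a : A₂, a • z = z')
    (hfree₂ : ∀ (a : A₂) (z : X₂), a • z = z → a = 1)
    (x₁ : X₁) (x₂ : X₂) (σ₂ : A₁) (σ₁ : A₂)
    (χ : A₁ →* ℂˣ) (ψ : A₂ →* ℂˣ)
    (R : (X₁ →₀ ℂ) ⊗[ℂ] (X₂ →₀ ℂ) →ₗ[ℂ] (X₂ →₀ ℂ) ⊗[ℂ] (X₁ →₀ ℂ))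
    (hR : ∀ (u : X₁) (v : X₂),
      R (Finsupp.single u (1 : ℂ) ⊗ₜ[ℂ] Finsupp.single v (1 : ℂ))
        = Finsupp.single (σ₁ • v) (1 : ℂ) ⊗ₜ[ℂ] Finsupp.single (σ₂⁻¹ • u) (1 : ℂ)) :
    R ((∑ π : A₁, ((χ π⁻¹ : ℂˣ) : ℂ) • Finsupp.single (π • x₁) (1 : ℂ)) ⊗ₜ[ℂ]
        (∑ ρ : A₂, ((ψ ρ⁻¹ : ℂˣ) : ℂ) • Finsupp.single (ρ • x₂) (1 : ℂ)))
      = (((ψ σ₁ : ℂˣ) : ℂ) / ((χ σ₂ : ℂˣ) : ℂ)) •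
        ((∑ ρ : A₂, ((ψ ρ⁻¹ : ℂˣ) : ℂ) • Finsupp.single (ρ • x₂) (1 : ℂ)) ⊗ₜ[ℂ]
          (∑ π : A₁, ((χ π⁻¹ : ℂˣ) : ℂ) • Finsupp.single (π • x₁) (1 : ℂ))) := by
  have key : R ((∑ π : A₁, ((χ π⁻¹ : ℂˣ) : ℂ) • Finsupp.single (π • x₁) (1 : ℂ)) ⊗ₜ[ℂ]
        (∑ ρ : A₂, ((ψ ρ⁻¹ : ℂˣ) : ℂ) • Finsupp.single (ρ • x₂) (1 : ℂ)))
      = (∑ ρ : A₂, ((ψ ρ⁻¹ : ℂˣ) : ℂ) • Finsupp.single (σ₁ • ρ • x₂) (1 : ℂ)) ⊗ₜ[ℂ]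
        (∑ π : A₁, ((χ π⁻¹ : ℂˣ) : ℂ) • Finsupp.single (σ₂⁻¹ • π • x₁) (1 : ℂ)) := by
    simp only [TensorProduct.sum_tmul, TensorProduct.tmul_sum, map_sum,
      ← TensorProduct.smul_tmul', TensorProduct.tmul_smul, map_smul, hR, Finset.smul_sum]
    rw [Finset.sum_comm]
    exact Finset.sum_congr rfl fun _ _ => Finset.sum_congr rfl fun _ _ => smul_comm _ _ _
  rw [key, sum_character_smul_single_smul, sum_character_smul_single_smul,
    TensorProduct.smul_tmul_smul, map_inv, Units.val_inv_eq_inv_val, div_eq_mul_inv]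
end

section
/- Let X = {x₁, x₂, x₃, x₄, a} and let (X,r) be the nondegenerate square-free symmetric set determined by r(x,y) = (L_x(y), L_y⁻¹(x)), where L_a is the 4-cycle (x₁x₂x₃x₄), L_{x₁} = L_{x₃} is the transposition (x₂x₄), L_{x₂} = L_{x₄} is the transposition (x₁x₃), and every listed permutation fixes a. Let V = ℂX and let R : V ⊗ V → V ⊗ V be the linear extension of r. Then there do not exist a basis {y₁, y₂, y₃, y₄} of the span of {x₁, x₂, x₃, x₄} and nonzero complex scalars λᵢ (1 ≤ i ≤ 4) and μᵢⱼ (1 ≤ i,j ≤ 4) such that R(e_a ⊗ yᵢ) = λᵢ yᵢ ⊗ e_a for all i and R(yᵢ ⊗ yⱼ) = μᵢⱼ yⱼ ⊗ yᵢ for all i,j. -/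
/-! Statement 9: the multipermutation level 3 example
`X = {x₁,x₂,x₃,x₄,a}` with `L_a = (x₁x₂x₃x₄)`, `L_{x₁} = L_{x₃} = (x₂x₄)`,
`L_{x₂} = L_{x₄} = (x₁x₃)` (and `r(x,y) = (L_x y, L_y⁻¹ x)`) admits no basis of
the span of `{x₁,…,x₄}` in which the linear extension `R` of `r` is diagonal.

We model `X` as `Fin 5` with `x₁,…,x₄ = 0,…,3` and `a = 4`. -/

open scoped TensorProduct

namespace YB9

/-- The 4-cycle `(x₁x₂x₃x₄)` (fixing `a = 4`). -/
def cyc : Fin 5 → Fin 5 := fun x =>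
  if x = 0 then 1 else if x = 1 then 2 else if x = 2 then 3 else if x = 3 then 0 else 4

/-- The inverse 4-cycle. -/
def cycInv : Fin 5 → Fin 5 := fun x =>
  if x = 0 then 3 else if x = 1 then 0 else if x = 2 then 1 else if x = 3 then 2 else 4

/-- The transposition `(x₂x₄)`, i.e. swapping `1` and `3`. -/
def sw13 : Fin 5 → Fin 5 := fun x => if x = 1 then 3 else if x = 3 then 1 else x

/-- The transposition `(x₁x₃)`, i.e. swapping `0` and `2`. -/
def sw02 : Fin 5 → Fin 5 := fun x => if x = 0 then 2 else if x = 2 then 0 else x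

/-- The left actions: `L_a = cyc`, `L_{x₁} = L_{x₃} = (x₂x₄)`, `L_{x₂} = L_{x₄} = (x₁x₃)`. -/
def L : Fin 5 → Fin 5 → Fin 5 := fun x =>
  if x = 4 then cyc else if x = 0 ∨ x = 2 then sw13 else sw02

/-- The inverses of the left actions. -/
def Linv : Fin 5 → Fin 5 → Fin 5 := fun x => if x = 4 then cycInv else L x

/-- The solution `r(x,y) = (L_x y, L_y⁻¹ x)`. -/
def rr : Fin 5 × Fin 5 → Fin 5 × Fin 5 := fun p => (L p.1 p.2, Linv p.2 p.1)

/-- The basis vectors `e_x` of `V = ℂX`. -/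
noncomputable def e (x : Fin 5) : Fin 5 →₀ ℂ := Finsupp.single x 1

theorem rr_injective : Function.Injective rr := by
  decide

/-- The coefficient of `R (u ⊗ v)` at `rr (x, z)` is the coefficient of `u ⊗ v` at `(x, z)`. -/
theorem coeff_map_tmul
    (R : (Fin 5 →₀ ℂ) ⊗[ℂ] (Fin 5 →₀ ℂ) →ₗ[ℂ] (Fin 5 →₀ ℂ) ⊗[ℂ] (Fin 5 →₀ ℂ))
    (hR : ∀ x y : Fin 5,
      R (e x ⊗ₜ[ℂ] e y) = e (rr (x, y)).1 ⊗ₜ[ℂ] e (rr (x, y)).2)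
    (u v : Fin 5 →₀ ℂ) (x z : Fin 5) :
    finsuppTensorFinsupp' ℂ (Fin 5) (Fin 5) (R (u ⊗ₜ[ℂ] v)) (rr (x, z)) = u x * v z := by
  have h : Finsupp.lapply (rr (x, z)) ∘ₗ
        (finsuppTensorFinsupp' ℂ (Fin 5) (Fin 5)).toLinearMap ∘ₗ R =
      Finsupp.lapply (x, z) ∘ₗ (finsuppTensorFinsupp' ℂ (Fin 5) (Fin 5)).toLinearMap := by
    ext i j
    have h₁ := hR i j
    simp only [e] at h₁
    simp [h₁, Finsupp.single_apply, rr_injective.eq_iff]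
  have h₁ := LinearMap.congr_fun h (u ⊗ₜ[ℂ] v)
  simpa using h₁

/-- If a linear functional vanishes on a family spanning the span of `e 0, …, e 3`, it vanishes
at `e 0`. -/
theorem apply_e_zero_eq_zero (y : Fin 4 → (Fin 5 →₀ ℂ))
    (hy : Submodule.span ℂ (Set.range y) = Submodule.span ℂ (e '' {0, 1, 2, 3}))
    (f : (Fin 5 →₀ ℂ) →ₗ[ℂ] ℂ) (hf : ∀ i, f (y i) = 0) : f (e 0) = 0 := by
  have h₀ : e 0 ∈ Submodule.span ℂ (Set.range y) := by
    rw [hy]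
    exact Submodule.subset_span ⟨0, by simp, rfl⟩
  have h₁ : Submodule.span ℂ (Set.range y) ≤ LinearMap.ker f := by
    rw [Submodule.span_le]
    rintro _ ⟨i, rfl⟩
    exact hf i
  exact h₁ h₀

theorem stmt9
    (R : (Fin 5 →₀ ℂ) ⊗[ℂ] (Fin 5 →₀ ℂ) →ₗ[ℂ] (Fin 5 →₀ ℂ) ⊗[ℂ] (Fin 5 →₀ ℂ))
    (hR : ∀ x y : Fin 5,
      R (e x ⊗ₜ[ℂ] e y) = e (rr (x, y)).1 ⊗ₜ[ℂ] e (rr (x, y)).2) :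
    ¬ ∃ (y : Fin 4 → (Fin 5 →₀ ℂ)) (lam : Fin 4 → ℂ) (mu : Fin 4 → Fin 4 → ℂ),
      LinearIndependent ℂ y ∧
      (∀ i, y i ∈ Submodule.span ℂ (e '' {0, 1, 2, 3})) ∧
      Submodule.span ℂ (Set.range y) = Submodule.span ℂ (e '' {0, 1, 2, 3}) ∧
      (∀ i, lam i ≠ 0) ∧ (∀ i j, mu i j ≠ 0) ∧
      (∀ i, R (e 4 ⊗ₜ[ℂ] y i) = lam i • (y i ⊗ₜ[ℂ] e 4)) ∧
      (∀ i j, R (y i ⊗ₜ[ℂ] y j) = mu i j • (y j ⊗ₜ[ℂ] y i)) := by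
  rintro ⟨y, lam, mu, -, -, hspan, -, -, ha, hy⟩
  have hshift (i : Fin 4) (x z : Fin 5) (hxz : rr (4, x) = (z, 4)) : y i x = lam i * y i z := by
    have h := coeff_map_tmul R hR (e 4) (y i) 4 x
    rw [ha i, hxz] at h
    simpa [e] using h.symm
  have hflip (i j : Fin 4) (p q p' q' : Fin 5) (hpq : rr (p, q) = (q', p')) :
      y i p * y j q = mu i j * (y j q' * y i p') := by
    have h := coeff_map_tmul R hR (y i) (y j) p q
    rw [hy i j, hpq] at h
    simpa using h.symm
  have h₀₁ (i : Fin 4) : y i 0 = lam i * y i 1 := hshift i 0 1 (by decide)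
  have h₁₂ (i : Fin 4) : y i 1 = lam i * y i 2 := hshift i 1 2 (by decide)
  have h₂₃ (i : Fin 4) : y i 2 = lam i * y i 3 := hshift i 2 3 (by decide)
  have h₃₀ (i : Fin 4) : y i 3 = lam i * y i 0 := hshift i 3 0 (by decide)
  have hsq (i : Fin 4) : (y i 0 - y i 2) * (y i 0 + y i 2) = 0 := by
    linear_combination y i 0 * h₀₁ i + y i 0 * lam i * h₁₂ i - y i 2 * h₂₃ i -
      y i 2 * lam i * h₃₀ i
  obtain ⟨i, hi⟩ : ∃ i, y i 0 - y i 2 ≠ 0 := by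
    by_contra! h
    have h₀ := apply_e_zero_eq_zero y hspan (Finsupp.lapply 0 - Finsupp.lapply 2) h
    simp [e, LinearMap.sub_apply] at h₀
  obtain ⟨j, hj⟩ : ∃ j, y j 0 + y j 2 ≠ 0 := by
    by_contra! h
    have h₀ := apply_e_zero_eq_zero y hspan (Finsupp.lapply 0 + Finsupp.lapply 2) h
    simp [e, LinearMap.add_apply] at h₀
  have hi₂ : y i 2 = -y i 0 := by
    linear_combination (mul_eq_zero.mp (hsq i)).resolve_left hi
  have hj₂ : y j 2 = y j 0 := by
    linear_combination -(mul_eq_zero.mp (hsq j)).resolve_right hj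
  have hi₀ : y i 0 ≠ 0 := fun h => hi (by rw [hi₂, h]; ring)
  have hj₃ : y j 3 = y j 1 := by rw [h₃₀ j, h₁₂ j, hj₂]
  have hj₀ : y j 0 ≠ 0 := fun h => hj (by rw [hj₂, h]; ring)
  have hj₁ : y j 1 ≠ 0 := fun h => hj₀ (by rw [h₀₁ j, h, mul_zero])
  have hμ : mu i j = 1 := by
    have h := hflip i j 0 0 0 0 (by decide)
    refine mul_right_cancel₀ (mul_ne_zero hj₀ hi₀) ?_
    linear_combination -h
  have h := hflip i j 0 1 2 3 (by decide)
  rw [hi₂, hj₃, hμ] at h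
  refine mul_ne_zero hi₀ hj₁ ?_
  linear_combination h / 2

end YB9
end

section
/- Let k be a field, n a positive integer, and F : {1,…,n} × {1,…,n} → kˣ any function; set ρᵢⱼ = Fᵢⱼ · Fⱼᵢ⁻¹. Let A be the quotient of the free associative k-algebra on generators y₁,…,yₙ by the two-sided ideal generated by the elements yᵢyⱼ − ρᵢⱼ yⱼyᵢ for all i,j. Let B be the underlying vector space of the commutative polynomial algebra k[y₁,…,yₙ] equipped with the bilinear product • defined on monomials by y^α • y^β = (∏_{i,j} Fᵢⱼ^{αᵢβⱼ}) · y^{α+β} for multi-indices α, β ∈ ℕⁿ. Then B is an associative unital k-algebra (with unit the constant polynomial 1), and the assignment yᵢ ↦ yᵢ extends to a k-algebra isomorphism A ≅ B. -/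
/-! Statement 10: for any `F : {1,…,n}² → kˣ` with `ρᵢⱼ = Fᵢⱼ Fⱼᵢ⁻¹`, the
q-commutation algebra `A = k⟨y₁,…,yₙ⟩/(yᵢyⱼ − ρᵢⱼ yⱼyᵢ)` is isomorphic to the
vector space of `k[y₁,…,yₙ]` equipped with the cotwisted product
`y^α • y^β = (∏ Fᵢⱼ^{αᵢβⱼ}) y^{α+β}`, which is associative and unital. -/

namespace S10

variable {k : Type*} [Field k]

/-- The cotwisted `•`-product on the underlying space of `k[y₁,…,yₙ]`. -/
noncomputable def bul (n : ℕ) (F : Fin n → Fin n → kˣ)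
    (f g : MvPolynomial (Fin n) k) : MvPolynomial (Fin n) k :=
  f.support.sum fun α => g.support.sum fun β =>
    MvPolynomial.monomial (α + β)
      (f.coeff α * g.coeff β * ∏ i, ∏ j, ((F i j : k) ^ (α i * β j)))

/-- The q-commutation relations `yᵢyⱼ = ρᵢⱼ yⱼyᵢ` with `ρᵢⱼ = Fᵢⱼ Fⱼᵢ⁻¹`. -/
def qRel (n : ℕ) (F : Fin n → Fin n → kˣ) :
    FreeAlgebra k (Fin n) → FreeAlgebra k (Fin n) → Prop := fun a b =>
  ∃ i j : Fin n, a = FreeAlgebra.ι k i * FreeAlgebra.ι k j ∧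
    b = ((F i j : k) * (((F j i)⁻¹ : kˣ) : k)) •
        (FreeAlgebra.ι k j * FreeAlgebra.ι k i)

/-- The bicharacter `(α, β) ↦ ∏ Fᵢⱼ^{αᵢβⱼ}`. -/
def bichar {n : ℕ} (F : Fin n → Fin n → kˣ) (α β : Fin n →₀ ℕ) : k :=
  ∏ i, ∏ j, ((F i j : k) ^ (α i * β j))

section Bichar

variable {n : ℕ} (F : Fin n → Fin n → kˣ)

lemma bichar_add_left (α β γ : Fin n →₀ ℕ) :
    bichar F (α + β) γ = bichar F α γ * bichar F β γ := by
  simp [bichar, add_mul, pow_add, Finset.prod_mul_distrib]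

lemma bichar_add_right (α β γ : Fin n →₀ ℕ) :
    bichar F α (β + γ) = bichar F α β * bichar F α γ := by
  simp [bichar, mul_add, pow_add, Finset.prod_mul_distrib]

@[simp] lemma bichar_zero_left (β : Fin n →₀ ℕ) : bichar F 0 β = 1 := by
  simp [bichar]

@[simp] lemma bichar_zero_right (α : Fin n →₀ ℕ) : bichar F α 0 = 1 := by
  simp [bichar]

lemma bichar_single_left (i : Fin n) (β : Fin n →₀ ℕ) :
    bichar F (Finsupp.single i 1) β = ∏ j, (F i j : k) ^ β j := by
  rw [bichar, Finset.prod_eq_single i]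
  · simp
  · intro b _ hb
    simp [Finsupp.single_eq_of_ne hb]
  · simp

/-- The `•`-product as a bilinear map. -/
noncomputable def bulHom :
    MvPolynomial (Fin n) k →ₗ[k] MvPolynomial (Fin n) k →ₗ[k] MvPolynomial (Fin n) k :=
  (MvPolynomial.basisMonomials (Fin n) k).constr k fun α =>
    (MvPolynomial.basisMonomials (Fin n) k).constr k fun β =>
      MvPolynomial.monomial (α + β) (bichar F α β)

lemma bulHom_monomial (α β : Fin n →₀ ℕ) (a b : k) :
    bulHom F (MvPolynomial.monomial α a) (MvPolynomial.monomial β b) =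
      MvPolynomial.monomial (α + β) (a * b * bichar F α β) := by
  have key : bulHom F (MvPolynomial.monomial α 1) (MvPolynomial.monomial β 1) =
      MvPolynomial.monomial (α + β) (bichar F α β) := by
    have h (γ : Fin n →₀ ℕ) :
        MvPolynomial.monomial γ 1 = MvPolynomial.basisMonomials (Fin n) k γ := by simp
    rw [bulHom, h α, h β, Module.Basis.constr_basis, Module.Basis.constr_basis]
  have h : ∀ (γ : Fin n →₀ ℕ) (c : k),
      MvPolynomial.monomial γ c = c • MvPolynomial.monomial γ 1 := fun γ c => by
    rw [MvPolynomial.smul_monomial, smul_eq_mul, mul_one]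
  rw [h α a, h β b, map_smul, map_smul, LinearMap.smul_apply, key, MvPolynomial.smul_monomial,
    MvPolynomial.smul_monomial, smul_eq_mul, smul_eq_mul]
  congr 1
  ring

lemma bul_eq_bulHom (f g : MvPolynomial (Fin n) k) : bul n F f g = bulHom F f g := by
  conv_rhs => rw [← MvPolynomial.support_sum_monomial_coeff f,
    ← MvPolynomial.support_sum_monomial_coeff g]
  simp only [map_sum, LinearMap.sum_apply, bulHom_monomial]
  rw [Finset.sum_comm]
  rfl

lemma bulHom_assoc (f g h : MvPolynomial (Fin n) k) :
    bulHom F (bulHom F f g) h = bulHom F f (bulHom F g h) := by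
  induction f using MvPolynomial.induction_on' with
  | add p q hp hq => simp only [map_add, LinearMap.add_apply, hp, hq]
  | monomial α a =>
    induction g using MvPolynomial.induction_on' with
    | add p q hp hq => simp only [map_add, LinearMap.add_apply, hp, hq]
    | monomial β b =>
      induction h using MvPolynomial.induction_on' with
      | add p q hp hq => simp only [map_add, hp, hq]
      | monomial γ c =>
        simp only [bulHom_monomial, bichar_add_left, bichar_add_right, add_assoc]
        congr 1
        ring

lemma one_bulHom (f : MvPolynomial (Fin n) k) : bulHom F 1 f = f := by
  induction f using MvPolynomial.induction_on' with
  | add p q hp hq => simp only [map_add, hp, hq]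
  | monomial α a =>
    rw [← MvPolynomial.C_1, MvPolynomial.C_apply, bulHom_monomial]
    simp

lemma bulHom_one (f : MvPolynomial (Fin n) k) : bulHom F f 1 = f := by
  induction f using MvPolynomial.induction_on' with
  | add p q hp hq => simp only [map_add, LinearMap.add_apply, hp, hq]
  | monomial α a =>
    rw [← MvPolynomial.C_1, MvPolynomial.C_apply, bulHom_monomial]
    simp

end Bichar

/-- The algebra endomorphism of `k[y₁,…,yₙ]` rescaling each variable `yⱼ` by `uⱼ`. -/
noncomputable def scale {n : ℕ} (u : Fin n → k) :
    MvPolynomial (Fin n) k →ₐ[k] MvPolynomial (Fin n) k :=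
  MvPolynomial.aeval fun j => u j • MvPolynomial.X j

section Scale

variable {n : ℕ}

@[simp] lemma scale_X (u : Fin n → k) (j : Fin n) :
    scale u (MvPolynomial.X j) = u j • MvPolynomial.X j := by
  simp [scale]

lemma scale_scale (u v : Fin n → k) (f : MvPolynomial (Fin n) k) :
    scale u (scale v f) = scale (u * v) f := by
  have : (scale u).comp (scale v) = scale (u * v) := by
    ext1 j
    simp [smul_smul, mul_comm]
  exact DFunLike.congr_fun this f

lemma scale_one (f : MvPolynomial (Fin n) k) : scale 1 f = f := by
  have : scale (1 : Fin n → k) = AlgHom.id k _ := by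
    ext1 j
    simp
  exact DFunLike.congr_fun this f

lemma scale_monomial (u : Fin n → k) (α : Fin n →₀ ℕ) (a : k) :
    scale u (MvPolynomial.monomial α a) = MvPolynomial.monomial α (a * ∏ j, u j ^ α j) := by
  rw [scale, MvPolynomial.aeval_monomial, Finsupp.prod_fintype _ _ (by simp)]
  simp only [MvPolynomial.smul_eq_C_mul, mul_pow, Finset.prod_mul_distrib]
  rw [MvPolynomial.algebraMap_eq, MvPolynomial.monomial_eq,
    Finsupp.prod_fintype _ _ (by simp)]
  simp [mul_assoc]

lemma bulHom_X (F : Fin n → Fin n → kˣ) (i : Fin n) (f : MvPolynomial (Fin n) k) :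
    bulHom F (MvPolynomial.X i) f = MvPolynomial.X i * scale (fun j => (F i j : k)) f := by
  induction f using MvPolynomial.induction_on' with
  | add p q hp hq => simp only [map_add, hp, hq, mul_add]
  | monomial α a =>
    rw [MvPolynomial.X, bulHom_monomial, bichar_single_left, scale_monomial,
      MvPolynomial.monomial_mul]
    simp

end Scale

open scoped IsMulCommutative in
/-- A commuting family in an arbitrary algebra extends to a homomorphism from the polynomial
algebra. -/
lemma exists_algHom_of_commute {ι R : Type*} [Ring R] [Algebra k R] (t : ι → R)
    (ht : ∀ i j, t i * t j = t j * t i) :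
    ∃ θ : MvPolynomial ι k →ₐ[k] R, ∀ i, θ (MvPolynomial.X i) = t i := by
  have := Algebra.isMulCommutative_adjoin k (s := Set.range t) (by
    rintro _ ⟨i, rfl⟩ _ ⟨j, rfl⟩
    exact ht i j)
  let t' (i : ι) : Algebra.adjoin k (Set.range t) := ⟨t i, Algebra.subset_adjoin ⟨i, rfl⟩⟩
  let θ : MvPolynomial ι k →ₐ[k] Algebra.adjoin k (Set.range t) := MvPolynomial.aeval t'
  exact ⟨(Algebra.adjoin k (Set.range t)).val.comp θ, fun i => by simp [θ, t']⟩

/-- The class of `yᵢ` in the q-commutation algebra. -/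
noncomputable def gen {n : ℕ} (F : Fin n → Fin n → kˣ) (i : Fin n) : RingQuot (qRel n F) :=
  RingQuot.mkAlgHom k (qRel n F) (FreeAlgebra.ι k i)

section QAlgebra

variable {n : ℕ} (F : Fin n → Fin n → kˣ)

lemma gen_mul_gen (i j : Fin n) :
    gen F i * gen F j = ((F i j : k) * (((F j i)⁻¹ : kˣ) : k)) • (gen F j * gen F i) := by
  simp only [gen, ← map_mul, ← map_smul]
  exact RingQuot.mkAlgHom_rel k ⟨i, j, rfl, rfl⟩

/-- The universal property of the q-commutation algebra. -/
noncomputable def qLift {B : Type*} [Ring B] [Algebra k B] (b : Fin n → B)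
    (hb : ∀ i j, b i * b j = ((F i j : k) * (((F j i)⁻¹ : kˣ) : k)) • (b j * b i)) :
    RingQuot (qRel n F) →ₐ[k] B :=
  RingQuot.liftAlgHom k ⟨FreeAlgebra.lift k b, by
    rintro _ _ ⟨i, j, rfl, rfl⟩
    simpa using hb i j⟩

@[simp] lemma qLift_gen {B : Type*} [Ring B] [Algebra k B] (b : Fin n → B)
    (hb : ∀ i j, b i * b j = ((F i j : k) * (((F j i)⁻¹ : kˣ) : k)) • (b j * b i)) (i : Fin n) :
    qLift F b hb (gen F i) = b i := by
  simp [qLift, gen]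

lemma qAlg_induction {P : RingQuot (qRel n F) → Prop}
    (algebraMap : ∀ c : k, P (algebraMap k _ c)) (gen : ∀ i, P (gen F i))
    (mul : ∀ a b, P a → P b → P (a * b)) (add : ∀ a b, P a → P b → P (a + b))
    (a : RingQuot (qRel n F)) : P a := by
  obtain ⟨x, rfl⟩ := RingQuot.mkAlgHom_surjective k (qRel n F) a
  induction x using FreeAlgebra.induction with
  | grade0 c => simpa using algebraMap c
  | grade1 i => exact gen i
  | mul a b ha hb => simpa using mul _ _ ha hb
  | add a b ha hb => simpa using add _ _ ha hb

lemma qAlg_hom_ext {B : Type*} [Ring B] [Algebra k B] {f g : RingQuot (qRel n F) →ₐ[k] B}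
    (h : ∀ i, f (gen F i) = g (gen F i)) : f = g := by
  refine AlgHom.ext fun a => ?_
  induction a using qAlg_induction with
  | algebraMap c => simp
  | gen i => exact h i
  | mul a b ha hb => simp [ha, hb]
  | add a b ha hb => simp [ha, hb]

/-- The algebra endomorphism of the q-commutation algebra rescaling `yⱼ` by `uⱼ`. -/
noncomputable def qScale (u : Fin n → k) : RingQuot (qRel n F) →ₐ[k] RingQuot (qRel n F) :=
  qLift F (fun j => u j • gen F j) fun i j => by
    simp only [smul_mul_smul_comm, gen_mul_gen F i j, smul_smul]
    congr 1
    ring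

@[simp] lemma qScale_gen (u : Fin n → k) (j : Fin n) :
    qScale F u (gen F j) = u j • gen F j := by
  simp [qScale]

lemma qScale_comm (u v : Fin n → k) (a : RingQuot (qRel n F)) :
    qScale F u (qScale F v a) = qScale F v (qScale F u a) := by
  have : (qScale F u).comp (qScale F v) = (qScale F v).comp (qScale F u) :=
    qAlg_hom_ext F fun i => by simp [smul_smul, mul_comm]
  exact DFunLike.congr_fun this a

/-- The action of the q-commutation algebra on `k[y₁,…,yₙ]` by left `•`-multiplication. -/
noncomputable def bulAction : RingQuot (qRel n F) →ₐ[k] Module.End k (MvPolynomial (Fin n) k) :=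
  qLift F (fun i => bulHom F (MvPolynomial.X i)) fun i j => by
    refine LinearMap.ext fun f => ?_
    simp only [Module.End.mul_apply, LinearMap.smul_apply, bulHom_X, map_mul, scale_X,
      scale_scale, mul_comm (fun l => (F j l : k)), smul_mul_assoc, mul_smul_comm, smul_smul]
    rw [mul_assoc, Units.inv_mul, mul_one, mul_left_comm]

lemma bulAction_gen (i : Fin n) : bulAction F (gen F i) = bulHom F (MvPolynomial.X i) := by
  simp [bulAction]

lemma bulAction_apply (a : RingQuot (qRel n F)) (f : MvPolynomial (Fin n) k) :
    bulAction F a f = bulHom F (bulAction F a 1) f := by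
  induction a using qAlg_induction generalizing f with
  | algebraMap c => simp [Module.algebraMap_end_apply, one_bulHom]
  | gen i => rw [bulAction_gen, bulHom_one]
  | mul a b ha hb =>
    rw [map_mul, Module.End.mul_apply, Module.End.mul_apply, ha, hb, ha (bulAction F b 1),
      bulHom_assoc]
  | add a b ha hb =>
    rw [map_add, LinearMap.add_apply, LinearMap.add_apply, ha, hb, map_add, LinearMap.add_apply]

/-- The underlying linear map of the isomorphism `A ≅ B`. -/
noncomputable def toPoly : RingQuot (qRel n F) →ₗ[k] MvPolynomial (Fin n) k :=
  (LinearMap.applyₗ 1).comp (bulAction F).toLinearMap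

lemma toPoly_apply (a : RingQuot (qRel n F)) : toPoly F a = bulAction F a 1 := rfl

lemma toPoly_mul (a b : RingQuot (qRel n F)) :
    toPoly F (a * b) = bulHom F (toPoly F a) (toPoly F b) := by
  rw [toPoly_apply, map_mul, Module.End.mul_apply, bulAction_apply]
  rfl

lemma toPoly_gen (i : Fin n) : toPoly F (gen F i) = MvPolynomial.X i := by
  rw [toPoly_apply, bulAction_gen, bulHom_one]

lemma toPoly_one : toPoly F 1 = 1 := by
  simp [toPoly_apply]

lemma scale_mem_range_toPoly (f : MvPolynomial (Fin n) k) (u : Fin n → k) :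
    scale u f ∈ LinearMap.range (toPoly F) := by
  induction f using MvPolynomial.induction_on generalizing u with
  | C c =>
    refine ⟨c • 1, ?_⟩
    rw [map_smul, toPoly_one, ← MvPolynomial.algebraMap_eq, AlgHom.commutes,
      Algebra.algebraMap_eq_smul_one]
  | add p q hp hq => simpa using add_mem (hp u) (hq u)
  | mul_X p i hp =>
    obtain ⟨a, ha⟩ := hp ((fun j => (((F i j)⁻¹ : kˣ) : k)) * u)
    refine ⟨u i • (gen F i * a), ?_⟩
    have h : (fun j => (F i j : k)) * ((fun j => (((F i j)⁻¹ : kˣ) : k)) * u) = u := by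
      ext j
      simp
    rw [map_smul, toPoly_mul, toPoly_gen, ha, bulHom_X, scale_scale, h, map_mul, scale_X,
      mul_smul_comm, mul_comm]

lemma toPoly_surjective : Function.Surjective (toPoly F) := fun f => by
  simpa [scale_one] using scale_mem_range_toPoly F f 1

/-- Left multiplication by `yᵢ` precomposed with the rescaling `yⱼ ↦ Fᵢⱼ⁻¹ yⱼ`.
These operators on the q-commutation algebra commute. -/
noncomputable def untwist (i : Fin n) : Module.End k (RingQuot (qRel n F)) :=
  LinearMap.mulLeft k (gen F i) ∘ₗ (qScale F fun j => (((F i j)⁻¹ : kˣ) : k)).toLinearMap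

lemma untwist_apply (i : Fin n) (a : RingQuot (qRel n F)) :
    untwist F i a = gen F i * qScale F (fun j => (((F i j)⁻¹ : kˣ) : k)) a := rfl

lemma untwist_comm (i j : Fin n) : untwist F i * untwist F j = untwist F j * untwist F i := by
  ext1 a
  simp only [Module.End.mul_apply, untwist_apply, map_mul, qScale_gen, smul_mul_assoc,
    mul_smul_comm, ← mul_assoc]
  rw [gen_mul_gen F i j, qScale_comm, smul_mul_assoc, smul_smul, ← mul_assoc, Units.inv_mul,
    one_mul]

lemma toPoly_injective : Function.Injective (toPoly F) := by
  obtain ⟨θ, hθ⟩ := exists_algHom_of_commute (k := k) (untwist F) (untwist_comm F)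
  have hscale : ∀ (i : Fin n) (f : MvPolynomial (Fin n) k),
      qScale F (fun j => (((F i j)⁻¹ : kˣ) : k)) (θ (scale (fun j => (F i j : k)) f) 1) =
        θ f 1 := by
    intro i f
    induction f using MvPolynomial.induction_on with
    | C c =>
      rw [← MvPolynomial.algebraMap_eq, AlgHom.commutes, AlgHom.commutes]
      simp [Module.algebraMap_end_apply]
    | add p q hp hq => simp only [map_add, LinearMap.add_apply, hp, hq]
    | mul_X p j hp =>
      rw [mul_comm p, map_mul, map_mul, map_mul, scale_X, map_smul, hθ, smul_mul_assoc,
        LinearMap.smul_apply, Module.End.mul_apply, Module.End.mul_apply, untwist_apply,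
        untwist_apply, map_smul, map_mul, qScale_gen, smul_mul_assoc, smul_smul, Units.mul_inv,
        one_smul, qScale_comm, hp]
  have hinv : ∀ (a : RingQuot (qRel n F)) (f : MvPolynomial (Fin n) k),
      θ (bulAction F a f) 1 = a * θ f 1 := by
    intro a
    induction a using qAlg_induction with
    | algebraMap c => simp [Module.algebraMap_end_apply, Algebra.smul_def]
    | gen i =>
      intro f
      rw [bulAction_gen, bulHom_X, map_mul, hθ, Module.End.mul_apply, untwist_apply, hscale]
    | mul a b ha hb => intro f; rw [map_mul, Module.End.mul_apply, ha, hb, mul_assoc]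
    | add a b ha hb =>
      intro f
      rw [map_add, LinearMap.add_apply, map_add, LinearMap.add_apply, ha, hb, add_mul]
  refine Function.LeftInverse.injective (g := fun f => θ f 1) fun a => ?_
  simpa [toPoly_apply] using hinv a 1

end QAlgebra

theorem stmt10 (n : ℕ) (hn : 0 < n) (F : Fin n → Fin n → kˣ) :
    -- `B = (k[y₁,…,yₙ], •)` is an associative unital `k`-algebra
    (∀ f g h : MvPolynomial (Fin n) k,
        bul n F (bul n F f g) h = bul n F f (bul n F g h)) ∧
    (∀ f : MvPolynomial (Fin n) k, bul n F 1 f = f ∧ bul n F f 1 = f) ∧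
    -- and `yᵢ ↦ yᵢ` extends to a `k`-algebra isomorphism `A ≅ B`
    ∃ φ : RingQuot (qRel n F) ≃ₗ[k] MvPolynomial (Fin n) k,
      φ 1 = 1 ∧
      (∀ a b, φ (a * b) = bul n F (φ a) (φ b)) ∧
      (∀ i : Fin n,
        φ (RingQuot.mkAlgHom k (qRel n F) (FreeAlgebra.ι k i)) = MvPolynomial.X i) := by
  simp only [bul_eq_bulHom]
  exact ⟨bulHom_assoc F, fun f => ⟨one_bulHom F f, bulHom_one F f⟩,
    LinearEquiv.ofBijective (toPoly F) ⟨toPoly_injective F, toPoly_surjective F⟩,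
    toPoly_one F, toPoly_mul F, toPoly_gen F⟩

end S10
end

section
/- Let k be a field, G an abelian group, and A a commutative k-algebra that is G-graded (A = ⊕_{g ∈ G} A_g as k-modules, with A_g · A_h ⊆ A_{gh} and 1 ∈ A_e), equipped with an action of G on A by k-algebra automorphisms that preserve each graded component A_g. Define a new bilinear product • on A by f • h = Σ_{g ∈ G} f_g · (g · h), where f = Σ_{g} f_g is the decomposition of f into homogeneous components and g · h denotes the action of g on h. Then (A, •, 1) is an associative unital k-algebra. -/
/-! Statement 11: let `A` be a commutative `k`-algebra graded by an abelian
group `G`, with an action of `G` on `A` by algebra automorphisms preserving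
each graded component.  Then the braided-opposite product
`f • h = Σ_g f_g · (g · h)` is associative and unital (with unit `1`).

(The abelian group `G` is written additively, as is customary for gradings.) -/

namespace S11

/-- The braided-opposite product `f • h = Σ_g f_g · (g · h)`, where
`f = Σ_g f_g` is the decomposition into homogeneous components and `φ g`
is the action of `g`. -/
noncomputable def bul {k A G : Type*} [CommRing k] [CommRing A] [Algebra k A]
    [AddCommGroup G] [DecidableEq G] (ℳ : G → Submodule k A) [GradedAlgebra ℳ]
    (φ : G → A ≃ₐ[k] A) (f h : A) : A :=
  DFinsupp.sumAddHom
    (fun g => (AddMonoidHom.mulRight (φ g h)).comp ((ℳ g).subtype.toAddMonoidHom))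
    (DirectSum.decompose ℳ f)

theorem bul_of_mem {k A G : Type*} [CommRing k] [CommRing A] [Algebra k A]
    [AddCommGroup G] [DecidableEq G] (ℳ : G → Submodule k A) [GradedAlgebra ℳ]
    (φ : G → A ≃ₐ[k] A) {g : G} {f : A} (hf : f ∈ ℳ g) (h : A) :
    bul ℳ φ f h = f * φ g h := by
  rw [bul, DirectSum.decompose_of_mem ℳ hf]
  exact DFinsupp.sumAddHom_single (β := fun i => ℳ i) _ g (⟨f, hf⟩ : ℳ g)

theorem bul_add_left {k A G : Type*} [CommRing k] [CommRing A] [Algebra k A]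
    [AddCommGroup G] [DecidableEq G] (ℳ : G → Submodule k A) [GradedAlgebra ℳ]
    (φ : G → A ≃ₐ[k] A) (f f' h : A) :
    bul ℳ φ (f + f') h = bul ℳ φ f h + bul ℳ φ f' h := by
  simp only [bul, DirectSum.decompose_add]
  exact map_add _ _ _

theorem bul_zero_left {k A G : Type*} [CommRing k] [CommRing A] [Algebra k A]
    [AddCommGroup G] [DecidableEq G] (ℳ : G → Submodule k A) [GradedAlgebra ℳ]
    (φ : G → A ≃ₐ[k] A) (h : A) : bul ℳ φ 0 h = 0 := by
  simp [bul_of_mem ℳ φ (zero_mem (ℳ 0))]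

theorem bul_add_right {k A G : Type*} [CommRing k] [CommRing A] [Algebra k A]
    [AddCommGroup G] [DecidableEq G] (ℳ : G → Submodule k A) [GradedAlgebra ℳ]
    (φ : G → A ≃ₐ[k] A) (f h h' : A) :
    bul ℳ φ f (h + h') = bul ℳ φ f h + bul ℳ φ f h' := by
  induction f using DirectSum.Decomposition.inductionOn ℳ with
  | zero => simp [bul_zero_left]
  | homogeneous a => simp [bul_of_mem ℳ φ a.2, mul_add]
  | add a b ha hb => simp only [bul_add_left, ha, hb]; abel

theorem bul_zero_right {k A G : Type*} [CommRing k] [CommRing A] [Algebra k A]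
    [AddCommGroup G] [DecidableEq G] (ℳ : G → Submodule k A) [GradedAlgebra ℳ]
    (φ : G → A ≃ₐ[k] A) (f : A) : bul ℳ φ f 0 = 0 := by
  simpa using bul_add_right ℳ φ f 0 0

theorem stmt11 {k A G : Type*} [CommRing k] [CommRing A] [Algebra k A]
    [AddCommGroup G] [DecidableEq G]
    (ℳ : G → Submodule k A) [GradedAlgebra ℳ]
    (φ : G → A ≃ₐ[k] A)
    -- `φ` is an action of `G` on `A` by algebra automorphisms:
    (hφ0 : φ 0 = AlgEquiv.refl)
    (hφadd : ∀ g g' : G, φ (g + g') = (φ g).trans (φ g'))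
    -- which preserves each graded component:
    (hφpres : ∀ (g h : G) (a : A), a ∈ ℳ h → φ g a ∈ ℳ h) :
    (∀ f h l : A, bul ℳ φ (bul ℳ φ f h) l = bul ℳ φ f (bul ℳ φ h l)) ∧
    (∀ f : A, bul ℳ φ 1 f = f ∧ bul ℳ φ f 1 = f) := by
  refine ⟨fun f h l => ?_, fun f => ⟨?_, ?_⟩⟩
  · induction f using DirectSum.Decomposition.inductionOn ℳ with
    | zero => simp [bul_zero_left]
    | add a b ha hb => simp only [bul_add_left, ha, hb]
    | @homogeneous i a =>
      induction h using DirectSum.Decomposition.inductionOn ℳ with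
      | zero => simp [bul_zero_left, bul_zero_right]
      | add b c hb hc => simp only [bul_add_left, bul_add_right, hb, hc]
      | @homogeneous j b =>
        have hab : (a : A) * φ i b ∈ ℳ (i + j) :=
          SetLike.mul_mem_graded a.2 (hφpres i j b b.2)
        rw [bul_of_mem ℳ φ a.2, bul_of_mem ℳ φ hab, bul_of_mem ℳ φ b.2,
          bul_of_mem ℳ φ a.2, add_comm i j, hφadd, AlgEquiv.trans_apply, map_mul, mul_assoc]
  · rw [bul_of_mem ℳ φ (SetLike.one_mem_graded ℳ), hφ0, AlgEquiv.coe_refl, id_eq, one_mul]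
  · induction f using DirectSum.Decomposition.inductionOn ℳ with
    | zero => exact bul_zero_left ℳ φ 1
    | homogeneous a => rw [bul_of_mem ℳ φ a.2, map_one, mul_one]
    | add a b ha hb => rw [bul_add_left, ha, hb]

end S11
end

section
/- Let k be a field and (X,r) a finite nondegenerate square-free symmetric set satisfying L_{ˣy} = L_y for all x,y ∈ X, and let 𝒢 ⊆ Sym(X) be the (abelian) subgroup generated by {L_x : x ∈ X}. Grade the commutative polynomial algebra k[X] (polynomials in commuting variables indexed by X) by 𝒢 by assigning to a monomial x₁⋯x_m the degree L_{x₁}∘⋯∘L_{x_m} ∈ 𝒢, and let 𝒢 act on k[X] by the algebra automorphisms induced by its permutation action on the variables. Define the braided-opposite product f • h = Σ_{g ∈ 𝒢} f_g · (g · h) as in the crossed-module construction. Then: (i) x • y = x · (ˣy) for all x,y ∈ X; (ii) x • y = (ˣy) • (x^y) for all x,y ∈ X; and (iii) the assignment x ↦ x extends to a k-algebra isomorphism from the Yang–Baxter algebra 𝒜(k,X,r) (the quotient of the free associative k-algebra on X by the two-sided ideal generated by the elements x·y − (ˣy)·(x^y) for x,y ∈ X) onto (k[X], •). -/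
namespace YB

variable {X : Type*}

/-- The left action `L_x` as an element of the composition monoid `Function.End X`. -/
def laE (r : X × X → X × X) (x : X) : Function.End X := fun y => (r (x, y)).1

/-- The `𝒢`-degree of a monomial `x₁^{α₁}⋯x_m^{α_m}`: the composite
`L_{x₁}^{α₁} ∘ ⋯ ∘ L_{x_m}^{α_m}` (well defined since the `L_x` commute). -/
noncomputable def deg (r : X × X → X × X)
    (hc : ∀ x y : X, Commute (laE r x) (laE r y)) (α : X →₀ ℕ) : Function.End X :=
  α.support.noncommProd (fun x => laE r x ^ α x)
    (fun a _ b _ _ => Commute.pow_pow (hc a b) _ _)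

/-- The braided-opposite product `f • h = Σ_g f_g · (g · h)` on the polynomial
algebra `k[X]`, graded by `𝒢` via `deg` and with `𝒢` acting by renaming the
variables. -/
noncomputable def bul {k : Type*} [CommSemiring k] (r : X × X → X × X)
    (hc : ∀ x y : X, Commute (laE r x) (laE r y)) (f h : MvPolynomial X k) :
    MvPolynomial X k :=
  f.support.sum fun α =>
    MvPolynomial.monomial α (MvPolynomial.coeff α f) *
      MvPolynomial.rename (deg r hc α) h

/-- The Yang–Baxter relations `x·y = (ˣy)·(x^y)` in the free algebra on `X`. -/
def ybRel (k : Type*) [CommSemiring k] (r : X × X → X × X) :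
    FreeAlgebra k X → FreeAlgebra k X → Prop := fun a b =>
  ∃ x y : X, a = FreeAlgebra.ι k x * FreeAlgebra.ι k y ∧
    b = FreeAlgebra.ι k (r (x, y)).1 * FreeAlgebra.ι k (r (x, y)).2

open MvPolynomial

open scoped IsMulCommutative in
/-- A commuting family in a noncommutative algebra admits polynomial evaluation. -/
theorem exists_algHom_of_commute {k B : Type*} [CommRing k] [Ring B] [Algebra k B] (M : X → B)
    (hM : ∀ x y, Commute (M x) (M y)) :
    ∃ Φ : MvPolynomial X k →ₐ[k] B, ∀ x, Φ (MvPolynomial.X x) = M x := by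
  let S := Algebra.adjoin k (Set.range M)
  have : IsMulCommutative S := Algebra.isMulCommutative_adjoin k (by
    rintro _ ⟨x, rfl⟩ _ ⟨y, rfl⟩
    exact hM x y)
  exact ⟨S.val.comp (aeval fun x => ⟨M x, Algebra.subset_adjoin ⟨x, rfl⟩⟩), fun x => by simp⟩

open scoped IsMulCommutative in
/-- The degree factors through a commutative monoid, as the product of the powers of the `L_x`. -/
theorem exists_deg_eq.{u} {X : Type u} (r : X × X → X × X)
    (hc : ∀ x y : X, Commute (laE r x) (laE r y)) :
    ∃ (C : Type u) (_ : CommMonoid C) (i : C →* Function.End X) (c : X → C),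
      (∀ x y, laE r x = laE r y → c x = c y) ∧ (∀ x, i (c x) = laE r x) ∧
      ∀ α, deg r hc α = i (α.prod fun x n => c x ^ n) := by
  let S := Submonoid.closure (Set.range (laE r))
  have : IsMulCommutative S := Submonoid.isMulCommutative_closure _ (by
    rintro _ ⟨x, rfl⟩ _ ⟨y, rfl⟩
    exact hc x y)
  have hmem (x : X) : laE r x ∈ S := Submonoid.subset_closure (Set.mem_range_self x)
  let c (x : X) : S := ⟨laE r x, hmem x⟩
  refine ⟨S, inferInstance, S.subtype, c, fun x y h => Subtype.ext h, fun x => rfl, fun α => ?_⟩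
  rw [Finsupp.prod, ← Finset.noncommProd_eq_prod]
  exact (Finset.map_noncommProd α.support (fun x => c x ^ α x)
    (fun _ _ _ _ _ => Commute.all _ _) S.subtype).symm

section Degree

variable (r : X × X → X × X) (hc : ∀ x y : X, Commute (laE r x) (laE r y))

theorem deg_zero : deg r hc 0 = 1 := by
  obtain ⟨C, _, i, c, -, -, h⟩ := exists_deg_eq r hc
  simp [h]

theorem deg_single (x : X) : deg r hc (Finsupp.single x 1) = laE r x := by
  obtain ⟨C, _, i, c, -, hx, h⟩ := exists_deg_eq r hc
  simp [h, hx]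

theorem deg_add (α β : X →₀ ℕ) : deg r hc (α + β) = deg r hc α * deg r hc β := by
  obtain ⟨C, _, i, c, -, -, h⟩ := exists_deg_eq r hc
  rw [h, h, h, ← map_mul, Finsupp.prod_add_index' (by simp) (by simp [pow_add])]

theorem deg_mapDomain {g : X → X} (hg : ∀ y, laE r (g y) = laE r y) (α : X →₀ ℕ) :
    deg r hc (α.mapDomain g) = deg r hc α := by
  obtain ⟨C, _, i, c, hcc, -, h⟩ := exists_deg_eq r hc
  rw [h, h, Finsupp.prod_mapDomain_index (by simp) (by simp [pow_add])]
  simp only [hcc _ _ (hg _)]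

end Degree

section Product

variable {k : Type*} [CommSemiring k] (r : X × X → X × X)
  (hc : ∀ x y : X, Commute (laE r x) (laE r y))

theorem bul_eq_sum {f : MvPolynomial X k} {s : Finset (X →₀ ℕ)} (hs : f.support ⊆ s)
    (h : MvPolynomial X k) :
    bul r hc f h = ∑ α ∈ s, monomial α (coeff α f) * rename (deg r hc α) h :=
  Finset.sum_subset hs fun α _ hα => by simp [notMem_support_iff.mp hα]

theorem bul_monomial (α : X →₀ ℕ) (a : k) (h : MvPolynomial X k) :
    bul r hc (monomial α a) h = monomial α a * rename (deg r hc α) h := by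
  classical
  rw [bul_eq_sum r hc support_monomial_subset]
  simp

theorem bul_X (x : X) (h : MvPolynomial X k) :
    bul r hc (MvPolynomial.X x) h = MvPolynomial.X x * rename (la r x) h := by
  rw [MvPolynomial.X, bul_monomial, deg_single]
  rfl

theorem one_bul (h : MvPolynomial X k) : bul r hc 1 h = h := by
  rw [← C_1, C_apply, bul_monomial, deg_zero, ← C_apply, C_1, one_mul]
  exact rename_id_apply h

theorem bul_add (f g h : MvPolynomial X k) :
    bul r hc (f + g) h = bul r hc f h + bul r hc g h := by
  classical
  rw [bul_eq_sum r hc (support_add (p := f) (q := g)),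
    bul_eq_sum r hc (Finset.subset_union_left (s₁ := f.support) (s₂ := g.support)),
    bul_eq_sum r hc (Finset.subset_union_right (s₁ := f.support) (s₂ := g.support)),
    ← Finset.sum_add_distrib]
  simp [add_mul]

theorem bul_smul (a : k) (f h : MvPolynomial X k) :
    bul r hc (a • f) h = a • bul r hc f h := by
  rw [bul_eq_sum r hc (support_smul (a := a) (f := f)), bul, Finset.smul_sum]
  simp [← smul_mul_assoc, smul_monomial]

end Product

section Braiding

variable {r : X × X → X × X}

theorem la_fst_snd (hinv : Invol r) (x y : X) : la r (la r x y) (r (x, y)).2 = x :=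
  congrArg Prod.fst (hinv (x, y))

theorem la_snd (hinv : Invol r) (h2 : ∀ x y : X, la r (la r x y) = la r y) (x y : X) :
    la r (r (x, y)).2 = la r x := by
  rw [← h2 (la r x y) (r (x, y)).2, la_fst_snd hinv]

theorem la_comm_s12 (hc : ∀ x y : X, Commute (laE r x) (laE r y)) (x y z : X) :
    la r x (la r y z) = la r y (la r x z) :=
  congrFun (hc x y) z

/-- The left actions as permutations. -/
noncomputable def laEquiv (hnd : Nondeg r) (x : X) : Equiv.Perm X :=
  Equiv.ofBijective (la r x) (hnd.1 x)

/-- Equivariance of a quadratic map under a self-map of the underlying set. -/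
def Equivariant (r : X × X → X × X) (g : X → X) : Prop :=
  ∀ x y, r (g x, g y) = (g (r (x, y)).1, g (r (x, y)).2)

theorem equivariant_la (hnd : Nondeg r) (hinv : Invol r)
    (h2 : ∀ x y : X, la r (la r x y) = la r y)
    (hc : ∀ x y : X, Commute (laE r x) (laE r y)) (z : X) : Equivariant r (la r z) := by
  intro x y
  have h1 : la r (la r z x) (la r z y) = la r z (la r x y) := by rw [h2, la_comm_s12 hc]
  refine Prod.ext h1 ((hnd.1 y).1 ?_)
  have ha := la_fst_snd hinv (la r z x) (la r z y)
  have hb := la_fst_snd hinv x y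
  rw [h2, h2] at ha
  rw [h2] at hb
  rw [ha, la_comm_s12 hc, hb]

theorem Equivariant.symm {g : Equiv.Perm X} (hg : Equivariant r g) : Equivariant r g.symm := by
  intro x y
  have := hg (g.symm x) (g.symm y)
  simp only [Equiv.apply_symm_apply] at this
  simp [this]

end Braiding

section Algebra

variable {k : Type*} [Field k] {r : X × X → X × X}

variable (k r) in
/-- The generators of the Yang–Baxter algebra. -/
noncomputable def gen (x : X) : RingQuot (ybRel k r) :=
  RingQuot.mkAlgHom k (ybRel k r) (FreeAlgebra.ι k x)

theorem gen_mul_gen (x y : X) :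
    gen k r x * gen k r y = gen k r (r (x, y)).1 * gen k r (r (x, y)).2 := by
  simp only [gen, ← map_mul]
  exact RingQuot.mkAlgHom_rel k ⟨x, y, rfl, rfl⟩

theorem yb_induction {p : RingQuot (ybRel k r) → Prop}
    (scalar : ∀ c, p (algebraMap k _ c)) (gen : ∀ x, p (gen k r x))
    (mul : ∀ a b, p a → p b → p (a * b)) (add : ∀ a b, p a → p b → p (a + b)) (a) : p a := by
  obtain ⟨w, rfl⟩ := RingQuot.mkAlgHom_surjective k (ybRel k r) a
  induction w using FreeAlgebra.induction with
  | grade0 c => simpa using scalar c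
  | grade1 x => exact gen x
  | mul a b ha hb => simpa using mul _ _ ha hb
  | add a b ha hb => simpa using add _ _ ha hb

/-- The universal property of the Yang–Baxter algebra. -/
noncomputable def ybLift {B : Type*} [Ring B] [Algebra k B] (f : X → B)
    (hf : ∀ x y, f x * f y = f (r (x, y)).1 * f (r (x, y)).2) :
    RingQuot (ybRel k r) →ₐ[k] B :=
  RingQuot.liftAlgHom k ⟨FreeAlgebra.lift k f, by
    rintro _ _ ⟨x, y, rfl, rfl⟩
    simpa using hf x y⟩

@[simp]
theorem ybLift_gen {B : Type*} [Ring B] [Algebra k B] (f : X → B)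
    (hf : ∀ x y, f x * f y = f (r (x, y)).1 * f (r (x, y)).2) (x : X) :
    ybLift (k := k) f hf (gen k r x) = f x := by
  simp [ybLift, gen]

/-- The endomorphism of the Yang–Baxter algebra induced by an equivariant map. -/
noncomputable def ybMap (k : Type*) [Field k] {g : X → X} (hg : Equivariant r g) :
    RingQuot (ybRel k r) →ₐ[k] RingQuot (ybRel k r) :=
  ybLift (fun x => gen k r (g x)) fun x y => by rw [gen_mul_gen, hg]

@[simp]
theorem ybMap_gen {g : X → X} (hg : Equivariant r g) (x : X) :
    ybMap k hg (gen k r x) = gen k r (g x) :=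
  ybLift_gen _ _ x

theorem ybMap_ybMap_eq {g h g' h' : X → X} (hg : Equivariant r g) (hh : Equivariant r h)
    (hg' : Equivariant r g') (hh' : Equivariant r h') (H : ∀ x, g (h x) = g' (h' x)) (a) :
    ybMap k hg (ybMap k hh a) = ybMap k hg' (ybMap k hh' a) := by
  induction a using yb_induction with
  | scalar c => simp
  | gen x => simp [H]
  | mul a b ha hb => simp [ha, hb]
  | add a b ha hb => simp [ha, hb]

theorem ybMap_symm_apply {g : Equiv.Perm X} (hg : Equivariant r g) (a) :
    ybMap k hg (ybMap k hg.symm a) = a := by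
  induction a using yb_induction with
  | scalar c => simp
  | gen x => simp
  | mul a b ha hb => simp [ha, hb]
  | add a b ha hb => simp [ha, hb]

variable (k r) in
/-- The operator `f ↦ x * L_x(f)` of left `•`-multiplication by a variable. -/
noncomputable def mulVar (x : X) : Module.End k (MvPolynomial X k) :=
  LinearMap.mulLeft k (MvPolynomial.X x) ∘ₗ (rename (la r x)).toLinearMap

@[simp]
theorem mulVar_apply (x : X) (f : MvPolynomial X k) :
    mulVar k r x f = MvPolynomial.X x * rename (la r x) f := rfl

theorem mulVar_mul_mulVar (hinv : Invol r) (h2 : ∀ x y : X, la r (la r x y) = la r y)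
    (hc : ∀ x y : X, Commute (laE r x) (laE r y)) (x y : X) :
    mulVar k r x * mulVar k r y = mulVar k r (r (x, y)).1 * mulVar k r (r (x, y)).2 := by
  have hu : la r (r (x, y)).1 = la r y := h2 x y
  have hv := la_snd hinv h2 x y
  have hx := la_fst_snd hinv x y
  have hcomp : la r x ∘ la r y = la r y ∘ la r x := hc x y
  rw [h2] at hx
  refine LinearMap.ext fun f => ?_
  simp only [Module.End.mul_apply, mulVar_apply, map_mul, rename_X, rename_rename, hu, hv, hcomp,
    hx, ← mul_assoc]
  rw [mul_comm (MvPolynomial.X x)]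
  rfl

/-- The representation of the Yang–Baxter algebra on polynomials by left `•`-multiplication. -/
noncomputable def ybRep (k : Type*) [Field k] (hinv : Invol r)
    (h2 : ∀ x y : X, la r (la r x y) = la r y)
    (hc : ∀ x y : X, Commute (laE r x) (laE r y)) :
    RingQuot (ybRel k r) →ₐ[k] Module.End k (MvPolynomial X k) :=
  ybLift (mulVar k r) (mulVar_mul_mulVar hinv h2 hc)

@[simp]
theorem ybRep_gen (hinv : Invol r) (h2 : ∀ x y : X, la r (la r x y) = la r y)
    (hc : ∀ x y : X, Commute (laE r x) (laE r y)) (x : X) :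
    ybRep k hinv h2 hc (gen k r x) = mulVar k r x :=
  ybLift_gen _ _ x

theorem mulVar_bul (h2 : ∀ x y : X, la r (la r x y) = la r y)
    (hc : ∀ x y : X, Commute (laE r x) (laE r y)) (x : X) (f h : MvPolynomial X k) :
    mulVar k r x (bul r hc f h) = bul r hc (mulVar k r x f) h := by
  induction f using MvPolynomial.induction_on' with
  | add p q hp hq => rw [map_add, bul_add, bul_add, map_add, hp, hq]
  | monomial α a =>
    have hm : mulVar k r x (monomial α a) =
        monomial (Finsupp.single x 1 + α.mapDomain (la r x)) a := by
      rw [mulVar_apply, rename_monomial, MvPolynomial.X, monomial_mul, one_mul]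
    rw [hm, bul_monomial, bul_monomial, ← hm, deg_add, deg_single,
      deg_mapDomain r hc (g := la r x) fun y => h2 x y]
    have hr : rename (la r x) (rename (deg r hc α) h) = rename (laE r x * deg r hc α) h :=
      rename_rename _ _ h
    rw [mulVar_apply, mulVar_apply, map_mul, hr, mul_assoc]

theorem ybRep_bul (hinv : Invol r) (h2 : ∀ x y : X, la r (la r x y) = la r y)
    (hc : ∀ x y : X, Commute (laE r x) (laE r y)) (a) (f h : MvPolynomial X k) :
    ybRep k hinv h2 hc a (bul r hc f h) = bul r hc (ybRep k hinv h2 hc a f) h := by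
  induction a using yb_induction generalizing f h with
  | scalar c => simp [Module.algebraMap_end_apply, bul_smul]
  | gen x => rw [ybRep_gen, mulVar_bul h2]
  | mul a b ha hb => simp only [map_mul, Module.End.mul_apply, ha, hb]
  | add a b ha hb => simp only [map_add, LinearMap.add_apply, bul_add, ha, hb]

theorem ybRep_ybMap (hinv : Invol r) (h2 : ∀ x y : X, la r (la r x y) = la r y)
    (hc : ∀ x y : X, Commute (laE r x) (laE r y)) {z : X} (hz : Equivariant r (la r z)) (a)
    (f : MvPolynomial X k) :
    ybRep k hinv h2 hc (ybMap k hz a) (rename (la r z) f) =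
      rename (la r z) (ybRep k hinv h2 hc a f) := by
  induction a using yb_induction generalizing f with
  | scalar c => simp [Module.algebraMap_end_apply]
  | gen x =>
    have hcomp : la r x ∘ la r z = la r z ∘ la r x := hc x z
    simp [rename_rename, h2, hcomp]
  | mul a b ha hb => simp only [map_mul, Module.End.mul_apply, ha, hb]
  | add a b ha hb => simp only [map_add, LinearMap.add_apply, ha, hb]

/-- The commuting operators `a ↦ x * L_x⁻¹(a)` on the Yang–Baxter algebra, through which
commutative polynomials act. -/
noncomputable def twistedMul (k : Type*) [Field k] (hnd : Nondeg r)
    (hE : ∀ z, Equivariant r (laEquiv hnd z)) (x : X) : Module.End k (RingQuot (ybRel k r)) :=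
  LinearMap.mulLeft k (gen k r x) ∘ₗ (ybMap k (hE x).symm).toLinearMap

@[simp]
theorem twistedMul_apply (hnd : Nondeg r) (hE : ∀ z, Equivariant r (laEquiv hnd z)) (x : X) (a) :
    twistedMul k hnd hE x a = gen k r x * ybMap k (hE x).symm a := rfl

theorem laEquiv_comm (hnd : Nondeg r) (hc : ∀ x y : X, Commute (laE r x) (laE r y)) (x y : X) :
    Commute (laEquiv hnd x) (laEquiv hnd y) :=
  Equiv.ext fun z => la_comm_s12 hc x y z

theorem commute_twistedMul (hnd : Nondeg r) (hE : ∀ z, Equivariant r (laEquiv hnd z))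
    (hinv : Invol r)
    (hc : ∀ x y : X, Commute (laE r x) (laE r y)) (x y : X) :
    Commute (twistedMul k hnd hE x) (twistedMul k hnd hE y) := by
  refine LinearMap.ext fun a => ?_
  simp only [Module.End.mul_apply, twistedMul_apply, map_mul, ybMap_gen, ← mul_assoc]
  congr 1
  · rw [gen_mul_gen]
    set w := (laEquiv hnd x).symm y with hw
    have hy : la r x w = y := (laEquiv hnd x).apply_symm_apply y
    have hv := la_fst_snd hinv x w
    have h1 : (r (x, w)).1 = y := hy
    rw [hy] at hv
    rw [h1, (Equiv.eq_symm_apply (laEquiv hnd y)).mpr hv]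
  · refine ybMap_ybMap_eq _ _ _ _ (fun z => ?_) a
    exact Equiv.congr_fun ((laEquiv_comm hnd hc x y).inv_inv).eq z

theorem ybMap_twistedMul (hnd : Nondeg r) (hE : ∀ z, Equivariant r (laEquiv hnd z))
    (h2 : ∀ x y : X, la r (la r x y) = la r y)
    (hc : ∀ x y : X, Commute (laE r x) (laE r y)) (z y : X) (a) :
    ybMap k (hE z) (twistedMul k hnd hE y a) =
      twistedMul k hnd hE (la r z y) (ybMap k (hE z) a) := by
  have h : laEquiv hnd (la r z y) = laEquiv hnd y := Equiv.ext fun w => congrFun (h2 z y) w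
  simp only [twistedMul_apply, map_mul, ybMap_gen]
  congr 1
  refine ybMap_ybMap_eq _ _ _ _ (fun w => ?_) a
  rw [h]
  exact Equiv.congr_fun ((laEquiv_comm hnd hc z y).inv_right).eq w

/-- Commutative polynomials map linearly to the Yang–Baxter algebra so that multiplication by a
variable becomes the corresponding twisted multiplication. -/
theorem exists_linearMap_twistedMul (hnd : Nondeg r) (hE : ∀ z, Equivariant r (laEquiv hnd z))
    (hinv : Invol r) (hc : ∀ x y : X, Commute (laE r x) (laE r y)) :
    ∃ ψ : MvPolynomial X k →ₗ[k] RingQuot (ybRel k r), ψ 1 = 1 ∧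
      ∀ x f, ψ (MvPolynomial.X x * f) = twistedMul k hnd hE x (ψ f) := by
  obtain ⟨Φ, hΦ⟩ := exists_algHom_of_commute (k := k) (twistedMul k hnd hE)
    (commute_twistedMul hnd hE hinv hc)
  exact ⟨LinearMap.applyₗ 1 ∘ₗ Φ.toLinearMap, by simp, fun x f => by simp [hΦ]⟩

/-- The orbit map at `1` of left `•`-multiplication is a linear isomorphism. -/
theorem bijective_ybRep_one (hnd : Nondeg r) (hinv : Invol r)
    (h2 : ∀ x y : X, la r (la r x y) = la r y)
    (hc : ∀ x y : X, Commute (laE r x) (laE r y)) :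
    Function.Bijective fun a => ybRep k hinv h2 hc a 1 := by
  have hE : ∀ z, Equivariant r (laEquiv hnd z) := equivariant_la hnd hinv h2 hc
  obtain ⟨ψ, hψ1, hψ⟩ := exists_linearMap_twistedMul (k := k) hnd hE hinv hc
  have hψC (c : k) : ψ (C c) = algebraMap k _ c := by
    rw [← mul_one (C c), ← smul_eq_C_mul, map_smul, hψ1, Algebra.algebraMap_eq_smul_one]
  have hψrename (z : X) (f) : ψ (rename (la r z) f) = ybMap k (hE z) (ψ f) := by
    induction f using MvPolynomial.induction_on with
    | C c => simp [hψC]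
    | add p q hp hq => simp [hp, hq]
    | mul_X p x hp =>
      rw [mul_comm, map_mul, rename_X, hψ, hψ, hp, ybMap_twistedMul hnd hE h2 hc]
  have hψrep (a) (f) : ψ (ybRep k hinv h2 hc a f) = a * ψ f := by
    induction a using yb_induction generalizing f with
    | scalar c =>
      rw [AlgHom.commutes, Module.algebraMap_end_apply, map_smul, Algebra.smul_def]
    | gen x =>
      have h := ybMap_ybMap_eq (k := k) (hE x).symm (hE x) (hE x) (hE x).symm (by simp) (ψ f)
      rw [ybRep_gen, mulVar_apply, hψ, hψrename, twistedMul_apply, h, ybMap_symm_apply]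
    | mul a b ha hb => simp only [map_mul, Module.End.mul_apply, ha, hb, mul_assoc]
    | add a b ha hb => simp only [map_add, LinearMap.add_apply, ha, hb, add_mul]
  refine Function.bijective_iff_has_inverse.mpr ⟨ψ, fun a => ?_, fun f => ?_⟩
  · rw [hψrep, hψ1, mul_one]
  induction f using MvPolynomial.induction_on with
  | C c => simp [hψC, Module.algebraMap_end_apply, smul_eq_C_mul]
  | add p q hp hq => simp only [map_add, LinearMap.add_apply, hp, hq]
  | mul_X p x hp =>
    have h := ybRep_ybMap hinv h2 hc (hE x) (ybMap k (hE x).symm (ψ p)) 1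
    have hs : ybMap k (hE x) (ybMap k (hE x).symm (ψ p)) = ψ p := ybMap_symm_apply _ _
    rw [map_one] at h
    simp only at hp ⊢
    rw [mul_comm, hψ, twistedMul_apply, map_mul, Module.End.mul_apply, ybRep_gen, mulVar_apply,
      ← h]
    exact congrArg _ ((congrArg (fun a => ybRep k hinv h2 hc a 1) hs).trans hp)

end Algebra


/-- for a finite nondegenerate square-free symmetric set with
`L_{ˣy} = L_y` (multipermutation level ≤ 2, so the left actions commute and the
grading is well defined), the braided-opposite product on `k[X]` satisfies
(i) `x • y = x·(ˣy)`, (ii) `x • y = (ˣy) • (x^y)`, and (iii) `x ↦ x` extends to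
a `k`-algebra isomorphism `𝒜(k,X,r) ≅ (k[X], •)`. -/
theorem stmt12 {k : Type*} [Field k] [Fintype X] (r : X × X → X × X)
    (hbij : Function.Bijective r) (hnd : Nondeg r) (hsf : SqFree r)
    (hinv : Invol r) (hybe : YBE r)
    (h2 : ∀ x y : X, la r (la r x y) = la r y)
    (hc : ∀ x y : X, Commute (laE r x) (laE r y)) :
    (∀ x y : X, bul (k := k) r hc (MvPolynomial.X x) (MvPolynomial.X y)
        = MvPolynomial.X x * MvPolynomial.X (la r x y)) ∧
    (∀ x y : X, bul (k := k) r hc (MvPolynomial.X x) (MvPolynomial.X y)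
        = bul (k := k) r hc (MvPolynomial.X (r (x, y)).1) (MvPolynomial.X (r (x, y)).2)) ∧
    ∃ φ : RingQuot (ybRel k r) ≃ₗ[k] MvPolynomial X k,
      φ 1 = 1 ∧
      (∀ a b, φ (a * b) = bul (k := k) r hc (φ a) (φ b)) ∧
      (∀ x : X,
        φ (RingQuot.mkAlgHom k (ybRel k r) (FreeAlgebra.ι k x)) = MvPolynomial.X x) := by
  have hX (x y : X) : bul (k := k) r hc (MvPolynomial.X x) (MvPolynomial.X y)
      = MvPolynomial.X x * MvPolynomial.X (la r x y) := by rw [bul_X, rename_X]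
  refine ⟨hX, fun x y => ?_, ?_⟩
  · have h : la r (r (x, y)).1 (r (x, y)).2 = x := la_fst_snd hinv x y
    rw [hX, hX, h, mul_comm]
    rfl
  · refine ⟨LinearEquiv.ofBijective (LinearMap.applyₗ 1 ∘ₗ (ybRep k hinv h2 hc).toLinearMap)
      (bijective_ybRep_one hnd hinv h2 hc), ?_, fun a b => ?_, fun x => ?_⟩
    · change ybRep k hinv h2 hc 1 1 = 1
      rw [map_one (ybRep k hinv h2 hc), Module.End.one_apply]
    · change ybRep k hinv h2 hc (a * b) 1 =
        bul r hc (ybRep k hinv h2 hc a 1) (ybRep k hinv h2 hc b 1)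
      rw [← ybRep_bul, one_bul, map_mul, Module.End.mul_apply]
    · change ybRep k hinv h2 hc (gen k r x) 1 = _
      rw [ybRep_gen, mulVar_apply, map_one, mul_one]

end YB
end

section
/- Let (X,r) be a nondegenerate square-free involutive set-theoretic solution of the Yang–Baxter equation (X not necessarily finite) satisfying ^{(x^y)}z = ˣz for all x,y,z ∈ X. Let 𝒢 ⊆ Sym(X) be the subgroup generated by {L_x : x ∈ X}. Then: (i) the left actions pairwise commute, so 𝒢 is abelian; (ii) L_{g(x)} = L_x for every g ∈ 𝒢 and x ∈ X; and consequently (iii) the map x ↦ L_x together with the natural action of 𝒢 on X makes X a crossed 𝒢-set, i.e. L_{g(x)} = g ∘ L_x ∘ g⁻¹ for all g ∈ 𝒢, x ∈ X. -/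
namespace YB

variable {X : Type*}

/-- for a nondegenerate square-free involutive solution of the
YBE (not necessarily finite) satisfying `^{(x^y)}z = ˣz` (the multipermutation
level ≤ 2 condition): (i) the left actions pairwise commute (so `𝒢` is
abelian); (ii) `L_{g(x)} = L_x` for all `g ∈ 𝒢`; hence (iii) `x ↦ L_x` with the
natural `𝒢`-action makes `X` a crossed `𝒢`-set: `L_{g(x)} = g ∘ L_x ∘ g⁻¹`. -/
theorem stmt13 (r : X × X → X × X) (hbij : Function.Bijective r)
    (hnd : Nondeg r) (hsf : SqFree r) (hinv : Invol r) (hybe : YBE r)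
    (ha : ∀ x y z : X, la r (r (x, y)).2 z = la r x z) :
    (∀ x y z : X, la r x (la r y z) = la r y (la r x z)) ∧
    (∀ g ∈ Gcal r, ∀ x : X, la r (g x) = la r x) ∧
    (∀ g ∈ Gcal r, ∀ x y : X, la r (g x) y = g (la r x (g⁻¹ y))) := by
  have hla : ∀ x y : X, la r (la r x y) = la r y := by
    intro x y
    funext z
    have h := ha (r (x, y)).1 (r (x, y)).2 z
    rw [Prod.mk.eta, hinv] at h
    exact h.symm
  have hcomm : ∀ x y z : X, la r x (la r y z) = la r y (la r x z) := by
    intro x y z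
    have h : la r (la r x y) (la r (r (x, y)).2 z) = la r x (la r y z) :=
      congrArg (fun p : X × X × X => p.1) (congrFun hybe (x, y, z))
    rw [hla, ha] at h
    exact h.symm
  have hinvar : ∀ g ∈ Gcal r, ∀ x : X, la r (g x) = la r x := by
    intro g hg
    induction hg using Subgroup.closure_induction with
    | mem g hg =>
      obtain ⟨a, hga⟩ := hg
      intro x
      rw [hga, hla]
    | one => intro x; rfl
    | mul g h _ _ ihg ihh =>
      intro x
      rw [Equiv.Perm.mul_apply, ihg, ihh]
    | inv g _ ih =>
      intro x
      rw [← ih (g⁻¹ x), ← Equiv.Perm.mul_apply, mul_inv_cancel, Equiv.Perm.one_apply]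
  have hgcomm : ∀ g ∈ Gcal r, ∀ x y : X, g (la r x y) = la r x (g y) := by
    intro g hg
    induction hg using Subgroup.closure_induction with
    | mem g hg =>
      obtain ⟨a, hga⟩ := hg
      intro x y
      rw [hga, hcomm]
    | one => intro x y; rfl
    | mul g h _ _ ihg ihh =>
      intro x y
      rw [Equiv.Perm.mul_apply, Equiv.Perm.mul_apply, ihh, ihg]
    | inv g _ ih =>
      intro x y
      rw [Equiv.Perm.inv_eq_iff_eq, ih, ← Equiv.Perm.mul_apply, mul_inv_cancel, Equiv.Perm.one_apply]
  refine ⟨hcomm, hinvar, fun g hg x y => ?_⟩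
  rw [hinvar g hg, hgcomm g hg, ← Equiv.Perm.mul_apply, mul_inv_cancel, Equiv.Perm.one_apply]

end YB
end

section
/- Let (X,r) be a nondegenerate quadratic set, let f : X × X → X × X be defined by f(x,y) = (ˣy, x), and let τ(x,y) = (y,x) be the flip map. Then (X,f) is a nondegenerate quadratic set with f⁻¹(x,y) = (y, L_y⁻¹(x)), and r = f ∘ τ ∘ f⁻¹ holds if and only if r is involutive and satisfies condition lri. -/
namespace YB

variable {X : Type*}

/-- Condition **lri**: `(ˣy)ˣ = y = ˣ(yˣ)`. -/
def Lri (r : X × X → X × X) : Prop :=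
  ∀ x y, ra r x (la r x y) = y ∧ la r x (ra r x y) = y

/-- The map `f(x,y) = (ˣy, x)`. -/
def fmap (r : X × X → X × X) : X × X → X × X := fun p => ((r p).1, p.1)

/-- for a nondegenerate quadratic set `(X,r)`, the map
`f(x,y) = (ˣy,x)` makes `(X,f)` a nondegenerate quadratic set, with
`f⁻¹(x,y) = (y, L_y⁻¹(x))`, and `r = f ∘ τ ∘ f⁻¹` (equivalently `r ∘ f = f ∘ τ`)
holds iff `r` is involutive and satisfies **lri**. -/
theorem stmt14 (r : X × X → X × X) (hbij : Function.Bijective r) (hnd : Nondeg r) :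
    -- `(X,f)` is a nondegenerate quadratic set:
    Function.Bijective (fmap r) ∧
    (∀ x : X, Function.Bijective (fun y => (fmap r (x, y)).1)) ∧
    (∀ y : X, Function.Bijective (fun x => (fmap r (x, y)).2)) ∧
    -- `f⁻¹(x,y) = (y, L_y⁻¹(x))`:
    (∀ x y z : X, fmap r (y, z) = (x, y) ↔ la r y z = x) ∧
    -- `r = f ∘ τ ∘ f⁻¹` iff `r` is involutive with lri:
    ((∀ x y : X, r (fmap r (x, y)) = fmap r (y, x)) ↔ (Invol r ∧ Lri r)) := by
  have mem (x y z : X) : fmap r (y, z) = (x, y) ↔ la r y z = x := by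
    simp [fmap, la]
  have bij : Function.Bijective (fmap r) := by
    constructor
    · rintro ⟨x, y⟩ ⟨x', y'⟩ h
      obtain ⟨h₁, rfl⟩ := Prod.mk.inj h
      rw [(hnd.1 x).injective h₁]
    · rintro ⟨a, x⟩
      obtain ⟨y, hy⟩ := (hnd.1 x).surjective a
      exact ⟨(x, y), (mem a x y).2 hy⟩
  refine ⟨bij, hnd.1, fun _ => Function.bijective_id, mem, ?_, ?_⟩
  · intro h
    refine ⟨fun p => ?_, fun x y => ?_⟩
    · obtain ⟨⟨x, y⟩, rfl⟩ := bij.surjective p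
      rw [h, h]
    · have left (z : X) : ra r x (la r x z) = z := congrArg Prod.snd (h x z)
      refine ⟨left y, ?_⟩
      obtain ⟨z, rfl⟩ := (hnd.1 x).surjective y
      rw [left]
  · rintro ⟨hinv, hlri⟩ x y
    have hsnd : (r (fmap r (x, y))).2 = y := (hlri x y).1
    have hr : r ((r (fmap r (x, y))).1, y) = fmap r (x, y) := by
      conv_rhs => rw [← hinv (fmap r (x, y))]
      exact congrArg r (Prod.ext rfl hsnd.symm)
    have hra : ra r y (r (fmap r (x, y))).1 = x := congrArg Prod.snd hr
    refine Prod.ext ?_ hsnd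
    have hla := (hlri y (r (fmap r (x, y))).1).2
    rw [hra] at hla
    exact hla.symm

end YB
end

section
/- Let (X,r) be a nondegenerate quadratic set satisfying condition lri, and let f(x,y) = (ˣy, x). Consider the conditions: (a) ^{(x^y)}z = ˣz for all x,y,z ∈ X; (b) f satisfies the Yang–Baxter equation; (c) r satisfies the Yang–Baxter equation. Then any two of (a), (b), (c) imply the third. -/
namespace YB

variable {X : Type*}

/-- The Yang–Baxter equation for `f(x,y) = (ˣy, x)` says that `L_x L_y = L_{ˣy} L_x`. -/
theorem ybe_fmap_iff (r : X × X → X × X) :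
    YBE (fmap r) ↔ ∀ x y z, la r (la r x y) (la r x z) = la r x (la r y z) := by
  simp [YBE, m12, m23, fmap, la, funext_iff]

/-- The Yang–Baxter equation for `r`, written componentwise. -/
theorem ybe_iff (r : X × X → X × X) :
    YBE r ↔ ∀ x y z,
      la r (la r x y) (la r (ra r y x) z) = la r x (la r y z) ∧
      ra r (la r (ra r y x) z) (la r x y) = la r (ra r (la r y z) x) (ra r z y) ∧
      ra r z (ra r y x) = ra r (ra r z y) (ra r (la r y z) x) := by
  simp [YBE, m12, m23, la, ra, funext_iff, Prod.ext_iff]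

/-- for a nondegenerate quadratic set with **lri**, among
(a) `^{(x^y)}z = ˣz` for all `x,y,z`, (b) `f` obeys the YBE, (c) `r` obeys the
YBE, any two imply the third. -/
theorem stmt16 (r : X × X → X × X) (hbij : Function.Bijective r) (hnd : Nondeg r)
    (hlri : Lri r) :
    (((∀ x y z : X, la r (r (x, y)).2 z = la r x z) ∧ YBE (fmap r)) → YBE r) ∧
    (((∀ x y z : X, la r (r (x, y)).2 z = la r x z) ∧ YBE r) → YBE (fmap r)) ∧
    ((YBE (fmap r) ∧ YBE r) → ∀ x y z : X, la r (r (x, y)).2 z = la r x z) := by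
  have hl (x) : Function.Injective (la r x) := (hnd.1 x).injective
  have left_right (x y) : la r x (ra r x y) = y := (hlri x y).2
  rw [ybe_fmap_iff, ybe_iff]
  change ((∀ x y z, la r (ra r y x) z = la r x z) ∧ _ → _) ∧
    ((∀ x y z, la r (ra r y x) z = la r x z) ∧ _ → _) ∧
    (_ → ∀ x y z, la r (ra r y x) z = la r x z)
  refine ⟨?_, ?_, ?_⟩
  · rintro ⟨ha, hb⟩ x y z
    refine ⟨by rw [ha, hb], ?_, ?_⟩
    · apply hl (la r x z)
      rw [ha, ha, left_right, hb, left_right]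
    · apply hl z
      apply hl y
      rw [left_right, left_right, ← hb y z, ← ha y z (ra r _ _), left_right, left_right]
  · rintro ⟨ha, hc⟩ x y z
    rw [← (hc x y z).1, ha]
  · rintro ⟨hb, hc⟩ x y z
    apply hl (la r x y)
    rw [(hc x y z).1, hb]

end YB
end
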